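/- arXiv:1711.07501 — 2 statements merged into one kernel-verified Lean document; each statement's English description precedes it below -/
import Mathlib

section
/- For every integer n ≥ 2, the n-th derivative of the implicit function at x₀ is given by y^{(n)}(x₀) = Σ_{α = (m_{l,r}) ∈ A_n} [(−1)^{Σ_{l+r≥2} m_{l,r}} · n! · (Σ_{l+r≥2} r·m_{l,r})! / ∏_{l+r≥2} (l!^{m_{l,r}} · r!^{m_{l,r}} · m_{l,r}!)] · [∏_{l+r≥2} ((Δ_l f_{y^r})(x₀, y₀))^{m_{l,r}}] / f_y(x₀, y₀)^{n + Σ_{l+r≥2} m_{l,r}}. -/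
open Filter Topology

/-- `pd f p r` is the mixed partial derivative `∂^(p+r) f / ∂x^p ∂y^r` of a function
of two real variables. -/
noncomputable def pd (f : ℝ → ℝ → ℝ) (p r : ℕ) : ℝ → ℝ → ℝ :=
  fun x y => iteratedDeriv p (fun x' => iteratedDeriv r (fun y' => f x' y') y) x

/-- `Delta f l g = Σ_{j=0}^{l} (−1)^j C(l,j) g_{x^{l−j} y^j} f_x^j f_y^{l−j}`. -/
noncomputable def Delta (f : ℝ → ℝ → ℝ) (l : ℕ) (g : ℝ → ℝ → ℝ) : ℝ → ℝ → ℝ :=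
  fun x y => ∑ j ∈ Finset.range (l + 1),
    (-1 : ℝ) ^ j * (l.choose j : ℝ) * pd g (l - j) j x y *
      (pd f 1 0 x y) ^ j * (pd f 0 1 x y) ^ (l - j)

/-- Membership in the set `A_n`. -/
def Amem (n : ℕ) (m : (ℕ × ℕ) →₀ ℕ) : Prop :=
  (∀ p ∈ m.support, 2 ≤ p.1 + p.2) ∧
  (m.sum fun p k => p.1 * k) = n ∧
  (m.sum fun p k => p.2 * k) + 1 = m.sum fun _ k => k

open Finset in
/-- The finitely supported exponent families on `I` with `Σ l m = n` and `Σ r m + k = Σ m`. -/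
noncomputable def profiles (I : Finset (ℕ × ℕ)) (n k : ℕ) : Finset ((ℕ × ℕ) →₀ ℕ) :=
  ((range (n + 1)).biUnion fun N => I.finsuppAntidiag N).filter fun m =>
    Finsupp.weight Prod.fst m = n ∧ Finsupp.weight Prod.snd m + k = m.degree

theorem two_mul_degree_le_weight_add_weight {m : (ℕ × ℕ) →₀ ℕ} (hm : ∀ p ∈ m.support, 2 ≤ p.1 + p.2) :
    2 * m.degree ≤ Finsupp.weight Prod.fst m + Finsupp.weight Prod.snd m := by
  simp only [Finsupp.weight_apply, Finsupp.degree_apply, Finsupp.sum, Finset.mul_sum,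
    ← Finset.sum_add_distrib, smul_eq_mul]
  refine Finset.sum_le_sum fun p hp => ?_
  nlinarith [hm p hp, Nat.zero_le (m p)]

theorem mem_profiles {I : Finset (ℕ × ℕ)} (hI : ∀ p ∈ I, 2 ≤ p.1 + p.2) {n k : ℕ}
    {m : (ℕ × ℕ) →₀ ℕ} :
    m ∈ profiles I n k ↔ m.support ⊆ I ∧ Finsupp.weight Prod.fst m = n ∧
      Finsupp.weight Prod.snd m + k = m.degree := by
  simp only [profiles, Finset.mem_filter, Finset.mem_biUnion, Finset.mem_range,
    Finset.mem_finsuppAntidiag']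
  constructor
  · rintro ⟨⟨N, -, -, hs⟩, h⟩
    exact ⟨hs, h⟩
  · rintro ⟨hs, h1, h2⟩
    have := two_mul_degree_le_weight_add_weight fun p hp => hI p (hs hp)
    exact ⟨⟨m.degree, by omega, rfl, hs⟩, h1, h2⟩

/-- The product `∏ c_p ^ m_p / m_p!`. -/
noncomputable def divPowProd (c : ℕ × ℕ → ℝ) (m : (ℕ × ℕ) →₀ ℕ) : ℝ :=
  m.prod fun p k => c p ^ k / (k.factorial : ℝ)

theorem divPowProd_sub_single (c : ℕ × ℕ → ℝ) {m : (ℕ × ℕ) →₀ ℕ} {i : ℕ × ℕ}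
    (hi : i ∈ m.support) :
    c i * divPowProd c (m - Finsupp.single i 1) = m i * divPowProd c m := by
  classical
  have hmi : m i ≠ 0 := Finsupp.mem_support_iff.1 hi
  have h0 : ∀ p : ℕ × ℕ, c p ^ 0 / ((0 : ℕ).factorial : ℝ) = 1 := by simp
  have key : ∀ a : (ℕ × ℕ) →₀ ℕ, a.support ⊆ m.support → divPowProd c a =
      c i ^ a i / ((a i).factorial : ℝ) *
        ∏ p ∈ m.support.erase i, c p ^ a p / ((a p).factorial : ℝ) := by
    intro a ha
    rw [divPowProd, Finsupp.prod_of_support_subset a ha _ fun p _ => h0 p]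
    exact (Finset.mul_prod_erase _ (fun p => c p ^ a p / ((a p).factorial : ℝ)) hi).symm
  rw [key m subset_rfl, key _ Finsupp.support_tsub]
  have hprod : ∏ p ∈ m.support.erase i, c p ^ (m - Finsupp.single i 1 : (ℕ × ℕ) →₀ ℕ) p /
      (((m - Finsupp.single i 1 : (ℕ × ℕ) →₀ ℕ) p).factorial : ℝ) =
      ∏ p ∈ m.support.erase i, c p ^ m p / ((m p).factorial : ℝ) := by
    refine Finset.prod_congr rfl fun p hp => ?_
    simp [Finsupp.single_eq_of_ne (Finset.ne_of_mem_erase hp)]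
  rw [hprod]
  obtain ⟨k, hk⟩ := Nat.exists_eq_succ_of_ne_zero hmi
  have hk' : (k.factorial : ℝ) ≠ 0 := by positivity
  simp only [Finsupp.tsub_apply, hk, Finsupp.single_eq_same, Nat.succ_eq_add_one,
    Nat.add_sub_cancel, Nat.factorial_succ]
  push_cast
  field_simp
  ring

/-- The summand of the Lagrange expansion of the `k`-th power of the solution of
`v = Σ c_{l,r} u^l v^r`. -/
noncomputable def lagrangeTerm (c : ℕ × ℕ → ℝ) (k : ℕ) (m : (ℕ × ℕ) →₀ ℕ) : ℝ :=
  if m = 0 then 1 else k * ((m.degree - 1).factorial : ℝ) * divPowProd c m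

theorem lagrangeTerm_eq_sum (c : ℕ × ℕ → ℝ) {k : ℕ} (hk : 1 ≤ k) {m : (ℕ × ℕ) →₀ ℕ}
    (hm : Finsupp.weight Prod.snd m + k = m.degree) :
    lagrangeTerm c k m =
      ∑ i ∈ m.support, c i * lagrangeTerm c (k - 1 + i.2) (m - Finsupp.single i 1) := by
  have hm0 : m ≠ 0 := by
    rintro rfl
    simp at hm
    omega
  have hdeg : ∀ i ∈ m.support, (m - Finsupp.single i 1).degree + 1 = m.degree := by
    intro i hi
    have hle : Finsupp.single i 1 ≤ m :=
      Finsupp.single_le_iff.2 (Nat.one_le_iff_ne_zero.2 (Finsupp.mem_support_iff.1 hi))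
    conv_rhs => rw [← tsub_add_cancel_of_le hle, map_add, Finsupp.degree_single]
  rcases Nat.lt_or_ge m.degree 2 with h | h
  · have h1 : m.degree = 1 := by omega
    obtain ⟨i, rfl⟩ : ∃ i, m = Finsupp.single i 1 := by
      obtain ⟨i, hi⟩ := Finsupp.support_nonempty_iff.2 hm0
      have h2 := hdeg i hi
      have h3 : m - Finsupp.single i 1 = 0 := by
        rw [← Finsupp.degree_eq_zero_iff]; omega
      have hle : Finsupp.single i 1 ≤ m :=
        Finsupp.single_le_iff.2 (Nat.one_le_iff_ne_zero.2 (Finsupp.mem_support_iff.1 hi))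
      exact ⟨i, le_antisymm (tsub_eq_zero_iff_le.1 h3) hle⟩
    have hk1 : k = 1 := by omega
    rw [Finsupp.support_single _ one_ne_zero]
    simp [lagrangeTerm, divPowProd, hk1]
  · obtain ⟨N, hN⟩ := Nat.exists_eq_add_of_le h
    have hterm : ∀ i ∈ m.support,
        c i * lagrangeTerm c (k - 1 + i.2) (m - Finsupp.single i 1) =
          ((k - 1 + i.2 : ℕ) * m i) * ((N.factorial : ℝ) * divPowProd c m) := by
      intro i hi
      have h2 := hdeg i hi
      have h3 : m - Finsupp.single i 1 ≠ 0 := by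
        rw [Ne, ← Finsupp.degree_eq_zero_iff]; omega
      have h4 : (m - Finsupp.single i 1).degree - 1 = N := by omega
      rw [lagrangeTerm, if_neg h3, h4]
      linear_combination ((k - 1 + i.2 : ℕ) : ℝ) * N.factorial * divPowProd_sub_single c hi
    have hcount : ∑ i ∈ m.support, (k - 1 + i.2) * m i = k * (N + 1) := by
      have e1 : ∑ i ∈ m.support, (k - 1 + i.2) * m i
          = (k - 1) * m.degree + Finsupp.weight Prod.snd m := by
        simp only [Finsupp.weight_apply, Finsupp.degree_apply, Finsupp.sum, Finset.mul_sum,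
          ← Finset.sum_add_distrib, smul_eq_mul]
        exact Finset.sum_congr rfl fun i _ => by ring
      obtain ⟨j, rfl⟩ := Nat.exists_eq_add_of_le hk
      rw [e1, hN]
      simp only [Nat.add_sub_cancel_left]
      rw [hN] at hm
      nlinarith
    rw [Finset.sum_congr rfl hterm, ← Finset.sum_mul, lagrangeTerm, if_neg hm0,
      show m.degree - 1 = N + 1 by omega, Nat.factorial_succ]
    have := congrArg (Nat.cast (R := ℝ)) hcount
    push_cast at this ⊢
    rw [this]
    ring

theorem sum_lagrangeTerm_rec {I : Finset (ℕ × ℕ)} (hI : ∀ p ∈ I, 2 ≤ p.1 + p.2)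
    (c : ℕ × ℕ → ℝ) (n : ℕ) {k : ℕ} (hk : 1 ≤ k) :
    ∑ m ∈ profiles I n k, lagrangeTerm c k m =
      ∑ i ∈ I with i.1 ≤ n, c i *
        ∑ m ∈ profiles I (n - i.1) (k - 1 + i.2), lagrangeTerm c (k - 1 + i.2) m := by
  classical
  rw [Finset.sum_congr rfl fun m hm => lagrangeTerm_eq_sum c hk ((mem_profiles hI).1 hm).2.2]
  simp only [Finset.mul_sum]
  rw [Finset.sum_sigma', Finset.sum_sigma']
  refine Finset.sum_bij' (fun a _ => ⟨a.2, a.1 - Finsupp.single a.2 1⟩)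
    (fun b _ => ⟨b.2 + Finsupp.single b.1 1, b.1⟩) ?_ ?_ ?_ ?_ ?_
  · rintro ⟨m, i⟩ h
    simp only [Finset.mem_sigma, mem_profiles hI, Finset.mem_filter] at h ⊢
    obtain ⟨⟨hs, h1, h2⟩, hi⟩ := h
    have hle : Finsupp.single i 1 ≤ m :=
      Finsupp.single_le_iff.2 (Nat.one_le_iff_ne_zero.2 (Finsupp.mem_support_iff.1 hi))
    obtain ⟨m', rfl⟩ := exists_add_of_le hle
    simp only [map_add, Finsupp.weight_single, Finsupp.degree_single, one_smul] at h1 h2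
    rw [add_tsub_cancel_left]
    refine ⟨⟨hs hi, by omega⟩, fun p hp => hs ?_, by omega, by omega⟩
    simp only [Finsupp.mem_support_iff, Finsupp.add_apply] at hp ⊢
    omega
  · rintro ⟨i, m⟩ h
    simp only [Finset.mem_sigma, mem_profiles hI, Finset.mem_filter] at h ⊢
    obtain ⟨⟨hi, hin⟩, hs, h1, h2⟩ := h
    refine ⟨⟨Finsupp.support_add.trans (Finset.union_subset hs ?_), ?_, ?_⟩, by simp⟩
    · rw [Finsupp.support_single _ one_ne_zero]
      simpa using hi
    · simp only [map_add, Finsupp.weight_single, one_smul]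
      omega
    · simp only [map_add, Finsupp.weight_single, Finsupp.degree_single, one_smul]
      omega
  · rintro ⟨m, i⟩ h
    simp only [Finset.mem_sigma] at h
    have hle : Finsupp.single i 1 ≤ m :=
      Finsupp.single_le_iff.2 (Nat.one_le_iff_ne_zero.2 (Finsupp.mem_support_iff.1 h.2))
    simp [tsub_add_cancel_of_le hle]
  · rintro ⟨i, m⟩ h
    simp
  · rintro ⟨m, i⟩ h
    rfl

theorem sum_lagrangeTerm_zero {I : Finset (ℕ × ℕ)} (hI : ∀ p ∈ I, 2 ≤ p.1 + p.2)
    (c : ℕ × ℕ → ℝ) (n : ℕ) :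
    ∑ m ∈ profiles I n 0, lagrangeTerm c 0 m = if n = 0 then 1 else 0 := by
  have h : ∀ m ∈ profiles I n 0, lagrangeTerm c 0 m = if m = 0 then 1 else 0 := fun m _ => by
    simp [lagrangeTerm]
  rw [Finset.sum_congr rfl h, Finset.sum_ite_eq']
  simp [mem_profiles hI, eq_comm]

theorem profiles_eq_empty {I : Finset (ℕ × ℕ)} (hI : ∀ p ∈ I, 2 ≤ p.1 + p.2) {n k : ℕ}
    (hnk : n < k) : profiles I n k = ∅ := by
  refine Finset.eq_empty_of_forall_notMem fun m hm => ?_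
  obtain ⟨hs, h1, h2⟩ := (mem_profiles hI).1 hm
  have := two_mul_degree_le_weight_add_weight fun p hp => hI p (hs hp)
  omega

/-- Lagrange inversion: the linear recurrence satisfied by the coefficients of the powers of
the solution of `v = Σ c_{l,r} u^l v^r` determines them. -/
theorem eq_sum_lagrangeTerm {I : Finset (ℕ × ℕ)} (hI : ∀ p ∈ I, 2 ≤ p.1 + p.2)
    (c : ℕ × ℕ → ℝ) (A : ℕ → ℕ → ℝ) (N : ℕ) (hA0 : ∀ n, A n 0 = if n = 0 then 1 else 0)
    (hAlt : ∀ n k, n < k → A n k = 0)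
    (hA : ∀ n ≤ N, ∀ k, 1 ≤ k → A n k = ∑ i ∈ I with i.1 ≤ n, c i * A (n - i.1) (k - 1 + i.2))
    (n k : ℕ) (hn : n ≤ N) : A n k = ∑ m ∈ profiles I n k, lagrangeTerm c k m := by
  induction hd : n - k using Nat.strong_induction_on generalizing n k with
  | _ d ih =>
    rcases Nat.lt_or_ge n k with h | h
    · rw [hAlt n k h, profiles_eq_empty hI h, Finset.sum_empty]
    rcases Nat.eq_zero_or_pos k with rfl | hk
    · rw [hA0, sum_lagrangeTerm_zero hI]
    rw [hA n hn k hk, sum_lagrangeTerm_rec hI c n hk]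
    refine Finset.sum_congr rfl fun i hi => ?_
    obtain ⟨hiI, hin⟩ := Finset.mem_filter.1 hi
    have h2 := hI i hiI
    rcases Nat.lt_or_ge (n - i.1) (k - 1 + i.2) with h' | h'
    · rw [hAlt _ _ h', profiles_eq_empty hI h', Finset.sum_empty]
    · rw [ih _ (by omega) (n - i.1) (k - 1 + i.2) (by omega) rfl]

/-- The `n`-th Taylor coefficient at `0`. -/
noncomputable def taylorCoeff (n : ℕ) (h : ℝ → ℝ) : ℝ := iteratedDeriv n h 0 / n.factorial

theorem taylorCoeff_zero (h : ℝ → ℝ) : taylorCoeff 0 h = h 0 := by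
  simp [taylorCoeff]

theorem taylorCoeff_succ (n : ℕ) (h : ℝ → ℝ) :
    taylorCoeff (n + 1) h = taylorCoeff n (deriv h) / (n + 1) := by
  rw [taylorCoeff, taylorCoeff, iteratedDeriv_succ', Nat.factorial_succ, div_div]
  push_cast
  rw [mul_comm]

theorem ContDiff.smooth_deriv {h : ℝ → ℝ} (hh : ContDiff ℝ (⊤ : ℕ∞) h) :
    ContDiff ℝ (⊤ : ℕ∞) (deriv h) :=
  (contDiff_infty_iff_deriv.1 hh).2

theorem taylorCoeff_add (n : ℕ) {g h : ℝ → ℝ} (hg : ContDiff ℝ (⊤ : ℕ∞) g)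
    (hh : ContDiff ℝ (⊤ : ℕ∞) h) :
    taylorCoeff n (fun u => g u + h u) = taylorCoeff n g + taylorCoeff n h := by
  have : (fun u => g u + h u) = g + h := rfl
  rw [taylorCoeff, this, iteratedDeriv_add (hg.contDiffAt.of_le (mod_cast le_top))
    (hh.contDiffAt.of_le (mod_cast le_top)), add_div]
  rfl

theorem taylorCoeff_const_mul (n : ℕ) (c : ℝ) (h : ℝ → ℝ) :
    taylorCoeff n (fun u => c * h u) = c * taylorCoeff n h := by
  rw [taylorCoeff, iteratedDeriv_const_mul_field, mul_div_assoc]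
  rfl

theorem taylorCoeff_congr (n : ℕ) {g h : ℝ → ℝ} (hgh : g =ᶠ[𝓝 0] h) :
    taylorCoeff n g = taylorCoeff n h := by
  rw [taylorCoeff, taylorCoeff, hgh.iteratedDeriv_eq]

theorem taylorCoeff_one (n : ℕ) : taylorCoeff n (fun _ => 1) = if n = 0 then 1 else 0 := by
  rcases n with _ | n
  · simp [taylorCoeff]
  · simp [taylorCoeff, iteratedDeriv_const]

theorem taylorCoeff_const_zero (n : ℕ) : taylorCoeff n (fun _ => 0) = 0 := by
  simp [taylorCoeff]

theorem taylorCoeff_id_mul (n : ℕ) {h : ℝ → ℝ} (hh : ContDiff ℝ (⊤ : ℕ∞) h) :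
    taylorCoeff (n + 1) (fun u => u * h u) = taylorCoeff n h := by
  have hderiv : ∀ g : ℝ → ℝ, ContDiff ℝ (⊤ : ℕ∞) g →
      deriv (fun u => u * g u) = fun u => g u + u * deriv g u := by
    intro g hg
    funext u
    refine ((hasDerivAt_id u).mul (hg.differentiable (by simp) u).hasDerivAt).deriv.trans ?_
    simp
  induction n generalizing h with
  | zero =>
    rw [taylorCoeff_succ, hderiv h hh]
    simp [taylorCoeff_zero]
  | succ n ih =>
    rw [taylorCoeff_succ, hderiv h hh, taylorCoeff_add _ hh (contDiff_fun_id.mul hh.smooth_deriv),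
      ih hh.smooth_deriv, taylorCoeff_succ n h]
    push_cast
    field_simp
    ring

theorem taylorCoeff_pow_mul (l n : ℕ) {h : ℝ → ℝ} (hh : ContDiff ℝ (⊤ : ℕ∞) h) :
    taylorCoeff n (fun u => u ^ l * h u) = if l ≤ n then taylorCoeff (n - l) h else 0 := by
  induction l generalizing n with
  | zero => simp
  | succ l ih =>
    have he : (fun u : ℝ => u ^ (l + 1) * h u) = fun u => u * (u ^ l * h u) := by
      funext u; ring
    rw [he]
    rcases n with _ | n
    · simp [taylorCoeff_zero]
    · rw [taylorCoeff_id_mul n ((contDiff_fun_id.pow l).mul hh), ih]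
      simp

theorem taylorCoeff_mul_pow_eq_zero {v : ℝ → ℝ} (hv : ContDiff ℝ (⊤ : ℕ∞) v) (hv0 : v 0 = 0)
    {n k : ℕ} (hnk : n < k) {h : ℝ → ℝ} (hh : ContDiff ℝ (⊤ : ℕ∞) h) :
    taylorCoeff n (fun u => h u * v u ^ k) = 0 := by
  induction n generalizing k h with
  | zero => simp [taylorCoeff_zero, hv0, hnk.ne']
  | succ n ih =>
    have hderiv : deriv (fun u => h u * v u ^ k) =
        fun u => deriv h u * v u ^ k + (k * h u * deriv v u) * v u ^ (k - 1) := by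
      funext u
      have := (hh.differentiable (by simp) u).hasDerivAt.mul
        ((hv.differentiable (by simp) u).hasDerivAt.pow k)
      refine (this.deriv).trans ?_
      simp only [Pi.pow_apply]
      ring
    have hs : ContDiff ℝ (⊤ : ℕ∞) fun u => k * h u * deriv v u :=
      (contDiff_const.mul hh).mul hv.smooth_deriv
    rw [taylorCoeff_succ, hderiv, taylorCoeff_add _ (hh.smooth_deriv.mul (hv.pow k))
      (hs.mul (hv.pow (k - 1))), ih (by omega) hh.smooth_deriv, ih (by omega) hs]
    simp

/-- The smooth real functions on the plane. -/
def smoothFun : Submodule ℝ (ℝ × ℝ → ℝ) where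
  carrier := {g | ContDiff ℝ (⊤ : ℕ∞) g}
  add_mem' {g h} (hg : ContDiff ℝ (⊤ : ℕ∞) g) (hh : ContDiff ℝ (⊤ : ℕ∞) h) := hg.add hh
  zero_mem' := (contDiff_const : ContDiff ℝ (⊤ : ℕ∞) fun _ : ℝ × ℝ => (0 : ℝ))
  smul_mem' c g (hg : ContDiff ℝ (⊤ : ℕ∞) g) := hg.const_smul c

theorem mem_smoothFun {g : ℝ × ℝ → ℝ} : g ∈ smoothFun ↔ ContDiff ℝ (⊤ : ℕ∞) g := Iff.rfl

theorem smoothFun.contDiff (g : smoothFun) : ContDiff ℝ (⊤ : ℕ∞) (g : ℝ × ℝ → ℝ) := g.2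

theorem smoothFun.differentiable (g : smoothFun) : Differentiable ℝ (g : ℝ × ℝ → ℝ) :=
  (smoothFun.contDiff g).differentiable (by simp)

/-- The directional derivative as an operator on smooth functions. -/
noncomputable def dirDeriv (e : ℝ × ℝ) : Module.End ℝ smoothFun where
  toFun g := ⟨fun p => fderiv ℝ g p e, mem_smoothFun.2 <|
    ((smoothFun.contDiff g).fderiv_right (m := (⊤ : ℕ∞)) (by simp)).clm_apply contDiff_const⟩
  map_add' g h := by
    ext p
    simp [fderiv_add (smoothFun.differentiable g p) (smoothFun.differentiable h p)]
  map_smul' c g := by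
    ext p
    simp [fderiv_const_smul (smoothFun.differentiable g p)]

theorem dirDeriv_apply (e : ℝ × ℝ) (g : smoothFun) (p : ℝ × ℝ) :
    (dirDeriv e g : ℝ × ℝ → ℝ) p = fderiv ℝ g p e := rfl

theorem dirDeriv_add_smul (a b : ℝ) (e e' : ℝ × ℝ) :
    dirDeriv (a • e + b • e') = a • dirDeriv e + b • dirDeriv e' := by
  ext g p
  simp [dirDeriv_apply]

theorem dirDeriv_commute (e e' : ℝ × ℝ) : Commute (dirDeriv e) (dirDeriv e') := by
  ext g p
  have hd : DifferentiableAt ℝ (fderiv ℝ (g : ℝ × ℝ → ℝ)) p :=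
    ((smoothFun.contDiff g).fderiv_right (m := (⊤ : ℕ∞)) (by simp)).differentiable (by simp) p
  have key : ∀ a b : ℝ × ℝ, (dirDeriv a (dirDeriv b g) : ℝ × ℝ → ℝ) p =
      fderiv ℝ (fderiv ℝ (g : ℝ × ℝ → ℝ)) p a b := by
    intro a b
    have : ((dirDeriv b g : smoothFun) : ℝ × ℝ → ℝ) = fun q => fderiv ℝ g q b := rfl
    rw [dirDeriv_apply, this, fderiv_clm_apply hd (by fun_prop)]
    simp
  have hsymm : IsSymmSndFDerivAt ℝ (g : ℝ × ℝ → ℝ) p :=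
    (smoothFun.contDiff g).contDiffAt.isSymmSndFDerivAt (by
      rw [minSmoothness_of_isRCLikeNormedField]
      exact WithTop.coe_le_coe.2 (le_top : (2 : ℕ∞) ≤ ⊤))
  change (dirDeriv e (dirDeriv e' g) : ℝ × ℝ → ℝ) p = (dirDeriv e' (dirDeriv e g) : ℝ × ℝ → ℝ) p
  rw [key, key, hsymm.eq]

/-- Taylor expansion of `h · (g ∘ γ)`, where `γ' = w + v' • e`. -/
theorem taylorCoeff_mul_comp {γ : ℝ → ℝ × ℝ} {v : ℝ → ℝ} {w e : ℝ × ℝ}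
    (hv : ContDiff ℝ (⊤ : ℕ∞) v) (hv0 : v 0 = 0)
    (hγ : ContDiff ℝ (⊤ : ℕ∞) γ) (hγ' : ∀ u, HasDerivAt γ (w + deriv v u • e) u)
    (n : ℕ) {L R : ℕ} (hL : n < L) (hR : n < R) (g : smoothFun) {h : ℝ → ℝ}
    (hh : ContDiff ℝ (⊤ : ℕ∞) h) :
    taylorCoeff n (fun u => h u * (g : ℝ × ℝ → ℝ) (γ u)) =
      ∑ l ∈ Finset.range L, ∑ r ∈ Finset.range R,
        ((dirDeriv w ^ l * dirDeriv e ^ r) g : smoothFun).1 (γ 0) /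
          (l.factorial * r.factorial) *
          taylorCoeff n (fun u => h u * (u ^ l * v u ^ r)) := by
  induction n generalizing L R g h with
  | zero =>
    obtain ⟨L, rfl⟩ := Nat.exists_eq_add_of_le' hL
    obtain ⟨R, rfl⟩ := Nat.exists_eq_add_of_le' hR
    simp only [taylorCoeff_zero, hv0]
    rw [Finset.sum_range_succ', Finset.sum_eq_zero, Finset.sum_range_succ', Finset.sum_eq_zero]
    · simp [mul_comm]
    · intro r _
      simp
    · intro l _
      exact Finset.sum_eq_zero fun r _ => by simp
  | succ n ih =>
    obtain ⟨L, rfl⟩ : ∃ L', L = L' + 1 := ⟨L - 1, by omega⟩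
    obtain ⟨R, rfl⟩ : ∃ R', R = R' + 1 := ⟨R - 1, by omega⟩
    have hv' := hv.smooth_deriv
    have hh' := hh.smooth_deriv
    have hcomp : ∀ g : smoothFun, ContDiff ℝ (⊤ : ℕ∞) fun u => (g : ℝ × ℝ → ℝ) (γ u) :=
      fun g => (smoothFun.contDiff g).comp hγ
    have hmon : ∀ l r : ℕ, ContDiff ℝ (⊤ : ℕ∞) fun u => u ^ l * v u ^ r :=
      fun l r => (contDiff_id.pow l).mul (hv.pow r)
    have hderiv : deriv (fun u => h u * (g : ℝ × ℝ → ℝ) (γ u)) = fun u =>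
        deriv h u * (g : ℝ × ℝ → ℝ) (γ u) + (h u * (dirDeriv w g : smoothFun).1 (γ u) +
          (h u * deriv v u) * (dirDeriv e g : smoothFun).1 (γ u)) := by
      funext u
      have h1 := ((smoothFun.differentiable g) (γ u)).hasFDerivAt.comp_hasDerivAt u (hγ' u)
      refine ((hh.differentiable (by simp) u).hasDerivAt.mul h1).deriv.trans ?_
      simp only [map_add, map_smul, smul_eq_mul, Function.comp, ← dirDeriv_apply]
      ring
    have hderiv' : ∀ l r : ℕ, deriv (fun u => h u * (u ^ l * v u ^ r)) = fun u =>
        deriv h u * (u ^ l * v u ^ r) + (l * (h u * (u ^ (l - 1) * v u ^ r)) +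
          r * ((h u * deriv v u) * (u ^ l * v u ^ (r - 1)))) := by
      intro l r
      funext u
      have h1 := ((hasDerivAt_id u).pow l).mul ((hv.differentiable (by simp) u).hasDerivAt.pow r)
      refine ((hh.differentiable (by simp) u).hasDerivAt.mul h1).deriv.trans ?_
      simp
      ring
    have hexp : ∀ l r : ℕ, taylorCoeff n (deriv fun u => h u * (u ^ l * v u ^ r)) =
        taylorCoeff n (fun u => deriv h u * (u ^ l * v u ^ r)) +
        (l * taylorCoeff n (fun u => h u * (u ^ (l - 1) * v u ^ r)) +
        r * taylorCoeff n (fun u => (h u * deriv v u) * (u ^ l * v u ^ (r - 1)))) := by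
      intro l r
      rw [hderiv', taylorCoeff_add _ (hh'.mul (hmon l r))
        ((contDiff_const.mul (hh.mul (hmon _ _))).add
          (contDiff_const.mul ((hh.mul hv').mul (hmon _ _)))),
        taylorCoeff_add _ (contDiff_const.mul (hh.mul (hmon _ _)))
          (contDiff_const.mul ((hh.mul hv').mul (hmon _ _))),
        taylorCoeff_const_mul, taylorCoeff_const_mul]
    simp only [taylorCoeff_succ, hexp]
    rw [hderiv, taylorCoeff_add _ (hh'.mul (hcomp g)) ((hh.mul (hcomp _)).add
        ((hh.mul hv').mul (hcomp _))),
      taylorCoeff_add _ (hh.mul (hcomp _)) ((hh.mul hv').mul (hcomp _)),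
      ih (L := L + 1) (R := R + 1) (by omega) (by omega) g hh',
      ih (L := L) (R := R + 1) (by omega) (by omega) _ hh,
      ih (L := L + 1) (R := R) (by omega) (by omega) _ (hh.mul hv')]
    simp only [mul_add, add_div, mul_div_assoc', Finset.sum_add_distrib, ← Finset.sum_div]
    congr 2 <;> congr 1
    · rw [Finset.sum_range_succ' _ L]
      simp only [Nat.cast_zero, zero_mul, mul_zero, Finset.sum_const_zero, add_zero]
      refine Finset.sum_congr rfl fun l _ => Finset.sum_congr rfl fun r _ => ?_
      have : (dirDeriv w ^ (l + 1) * dirDeriv e ^ r) g =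
          (dirDeriv w ^ l * dirDeriv e ^ r) (dirDeriv w g) := by
        rw [pow_succ, mul_assoc, ((dirDeriv_commute w e).pow_right r).eq]
        rfl
      rw [this, Nat.factorial_succ, Nat.add_sub_cancel]
      push_cast
      field_simp
    · refine Finset.sum_congr rfl fun l _ => ?_
      rw [Finset.sum_range_succ' _ R]
      simp only [Nat.cast_zero, zero_mul, mul_zero, add_zero]
      refine Finset.sum_congr rfl fun r _ => ?_
      have : (dirDeriv w ^ l * dirDeriv e ^ (r + 1)) g =
          (dirDeriv w ^ l * dirDeriv e ^ r) (dirDeriv e g) := by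
        rw [pow_succ, ← mul_assoc]
        rfl
      rw [this, Nat.factorial_succ, Nat.add_sub_cancel]
      push_cast
      field_simp

theorem exists_contDiff_eventuallyEq {E : Type*} [NormedAddCommGroup E] [NormedSpace ℝ E]
    [HasContDiffBump E] {F : E → ℝ} {a : E}
    (hF : ∀ᶠ p in 𝓝 a, ContDiffAt ℝ (⊤ : ℕ∞) F p) :
    ∃ G : E → ℝ, ContDiff ℝ (⊤ : ℕ∞) G ∧ G =ᶠ[𝓝 a] F := by
  obtain ⟨ε, hε, hball⟩ := Metric.eventually_nhds_iff_ball.1 hF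
  let χ : ContDiffBump a := ⟨ε / 4, ε / 2, by positivity, by linarith⟩
  refine ⟨fun p => χ p * F p, contDiff_iff_contDiffAt.2 fun p => ?_, ?_⟩
  · by_cases hp : p ∈ Metric.ball a ε
    · exact χ.contDiffAt.mul (hball p hp)
    · have hp' : p ∉ tsupport χ := by
        rw [χ.tsupport_eq]
        intro h
        refine hp (Metric.closedBall_subset_ball ?_ h)
        change ε / 2 < ε
        linarith
      refine (contDiffAt_const (c := (0 : ℝ))).congr_of_eventuallyEq ?_
      filter_upwards [notMem_tsupport_iff_eventuallyEq.1 hp'] with q hq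
      simp [hq]
  · filter_upwards [χ.eventuallyEq_one] with q hq
    simp [hq]

theorem pd_eventually_congr {F G : ℝ → ℝ → ℝ} {a : ℝ × ℝ}
    (h : ∀ᶠ q in 𝓝 a, F q.1 q.2 = G q.1 q.2) (p r : ℕ) :
    ∀ᶠ q in 𝓝 a, pd F p r q.1 q.2 = pd G p r q.1 q.2 := by
  filter_upwards [eventually_eventually_nhds.2 h] with q hq
  refine Filter.EventuallyEq.iteratedDeriv_eq p ?_
  have hx : Tendsto (fun x' : ℝ => (x', q.2)) (𝓝 q.1) (𝓝 q) :=
    (Continuous.prodMk_left q.2).tendsto q.1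
  filter_upwards [hx.eventually (eventually_eventually_nhds.2 hq)] with x' hx'
  refine Filter.EventuallyEq.iteratedDeriv_eq r ?_
  have hy : Tendsto (fun y' : ℝ => (x', y')) (𝓝 q.2) (𝓝 (x', q.2)) :=
    (Continuous.prodMk_right x').tendsto q.2
  exact hy.eventually hx'

theorem Delta_congr {f f' g g' : ℝ → ℝ → ℝ} {a b : ℝ}
    (hf : ∀ᶠ q in 𝓝 (a, b), f q.1 q.2 = f' q.1 q.2)
    (hg : ∀ᶠ q in 𝓝 (a, b), g q.1 q.2 = g' q.1 q.2) (l : ℕ) :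
    Delta f l g a b = Delta f' l g' a b := by
  have hf' := fun p r => (pd_eventually_congr hf p r).self_of_nhds
  have hg' := fun p r => (pd_eventually_congr hg p r).self_of_nhds
  simp only at hf' hg'
  simp only [Delta, hf', hg']

theorem pd_smoothFun (g : smoothFun) (p r : ℕ) :
    pd (fun x y => g.1 (x, y)) p r =
      fun x y => ((dirDeriv (1, 0) ^ p * dirDeriv (0, 1) ^ r) g : smoothFun).1 (x, y) := by
  have h2 : ∀ x : ℝ, iteratedDeriv r (fun y => g.1 (x, y)) =
      fun y => ((dirDeriv (0, 1) ^ r) g : smoothFun).1 (x, y) := by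
    intro x
    induction r with
    | zero => simp
    | succ r ih =>
      rw [iteratedDeriv_succ, ih, pow_succ']
      funext y
      have hd : HasDerivAt (fun y' : ℝ => (x, y')) ((0 : ℝ), (1 : ℝ)) y :=
        (hasDerivAt_const y x).prodMk (hasDerivAt_id y)
      exact ((smoothFun.differentiable ((dirDeriv (0, 1) ^ r) g)
        (x, y)).hasFDerivAt.comp_hasDerivAt y hd).deriv
  funext x y
  simp only [pd, h2]
  suffices h : iteratedDeriv p (fun x => ((dirDeriv (0, 1) ^ r) g : smoothFun).1 (x, y)) =
      fun x => ((dirDeriv (1, 0) ^ p * dirDeriv (0, 1) ^ r) g : smoothFun).1 (x, y) from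
    congrFun h x
  induction p with
  | zero => simp
  | succ p ih =>
    rw [iteratedDeriv_succ, ih, pow_succ']
    funext x
    have hd : HasDerivAt (fun x' : ℝ => (x', y)) ((1 : ℝ), (0 : ℝ)) x :=
      (hasDerivAt_id x).prodMk (hasDerivAt_const x y)
    exact ((smoothFun.differentiable ((dirDeriv (1, 0) ^ p * dirDeriv (0, 1) ^ r) g)
      (x, y)).hasFDerivAt.comp_hasDerivAt x hd).deriv

theorem Delta_smoothFun (f g : smoothFun) (l r : ℕ) (x y : ℝ) :
    Delta (fun x y => f.1 (x, y)) l (pd (fun x y => g.1 (x, y)) 0 r) x y =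
      ((dirDeriv (pd (fun x y => f.1 (x, y)) 0 1 x y • (1, 0) +
        (-pd (fun x y => f.1 (x, y)) 1 0 x y) • (0, 1)) ^ l * dirDeriv (0, 1) ^ r) g :
          smoothFun).1 (x, y) := by
  rw [dirDeriv_add_smul, add_comm, Commute.add_pow
    (((dirDeriv_commute _ _).smul_left _).smul_right _), Delta]
  have h0 : pd (fun x y => g.1 (x, y)) 0 r =
      fun x y => ((dirDeriv (0, 1) ^ r) g : smoothFun).1 (x, y) := by
    simp [pd_smoothFun]
  rw [h0]
  set a := pd (fun x y => f.1 (x, y)) 1 0 x y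
  set b := pd (fun x y => f.1 (x, y)) 0 1 x y
  simp only [pd_smoothFun, Finset.sum_mul, LinearMap.sum_apply, Submodule.coe_sum,
    Finset.sum_apply]
  refine Finset.sum_congr rfl fun j _ => ?_
  have hc : ((-a) • dirDeriv (0, 1)) ^ j * (b • dirDeriv (1, 0)) ^ (l - j) *
      ((l.choose j : ℕ) : Module.End ℝ smoothFun) * dirDeriv (0, 1) ^ r =
      ((-a) ^ j * b ^ (l - j) * (l.choose j : ℝ)) •
        (dirDeriv (1, 0) ^ (l - j) * dirDeriv (0, 1) ^ j * dirDeriv (0, 1) ^ r) := by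
    rw [smul_pow, smul_pow, ← nsmul_eq_mul', smul_mul_smul_comm,
      ((dirDeriv_commute (0, 1) (1, 0)).pow_pow j (l - j)).eq, ← Nat.cast_smul_eq_nsmul ℝ,
      smul_smul, smul_mul_assoc, mul_comm (l.choose j : ℝ)]
  rw [hc, LinearMap.smul_apply]
  change _ = _ * (((dirDeriv (1, 0) ^ (l - j) * dirDeriv (0, 1) ^ j) ((dirDeriv (0, 1) ^ r) g) :
    smoothFun).1 (x, y))
  rw [neg_pow]
  ring

/-- The implicit function formula for globally smooth data, with the Taylor coefficients taken
along the direction tangent to the level curve. -/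
theorem iteratedDeriv_implicit (g : smoothFun) {y : ℝ → ℝ} (hy : ContDiff ℝ (⊤ : ℕ∞) y) {x₀ : ℝ}
    (himp : ∀ᶠ x in 𝓝 x₀, g.1 (x, y x) = 0) {a b : ℝ}
    (ha : (dirDeriv (1, 0) g : smoothFun).1 (x₀, y x₀) = a)
    (hb : (dirDeriv (0, 1) g : smoothFun).1 (x₀, y x₀) = b) (hb0 : b ≠ 0)
    {n L : ℕ} (hn : 2 ≤ n) (hL : n < L) :
    iteratedDeriv n y x₀ = n.factorial / b ^ n *
      ∑ m ∈ profiles ((Finset.range L ×ˢ Finset.range L).filter fun p => 2 ≤ p.1 + p.2) n 1,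
        lagrangeTerm (fun p =>
          -(((dirDeriv (b • (1, 0) + (-a) • (0, 1)) ^ p.1 * dirDeriv (0, 1) ^ p.2) g :
            smoothFun).1 (x₀, y x₀) / (p.1.factorial * p.2.factorial)) / b) 1 m := by
  set w : ℝ × ℝ := b • (1, 0) + (-a) • (0, 1) with hw
  set I := (Finset.range L ×ˢ Finset.range L).filter fun p : ℕ × ℕ => 2 ≤ p.1 + p.2 with hI
  have hline : ContDiff ℝ (⊤ : ℕ∞) fun u : ℝ => x₀ + b * u := by fun_prop
  let v : ℝ → ℝ := fun u => y (x₀ + b * u) + (a * u - y x₀)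
  let γ : ℝ → ℝ × ℝ := fun u => (x₀ + b * u, y (x₀ + b * u))
  have hyc : ContDiff ℝ (⊤ : ℕ∞) fun u : ℝ => y (x₀ + b * u) := hy.comp hline
  have hv : ContDiff ℝ (⊤ : ℕ∞) v := hyc.add (by fun_prop)
  have hv0 : v 0 = 0 := by simp [v]
  have hγ : ContDiff ℝ (⊤ : ℕ∞) γ := hline.prodMk hyc
  have hγ0 : γ 0 = (x₀, y x₀) := by simp [γ]
  have hγ' : ∀ u, HasDerivAt γ (w + deriv v u • ((0 : ℝ), (1 : ℝ))) u := by
    intro u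
    have h1 : HasDerivAt (fun u : ℝ => x₀ + b * u) b u := by
      simpa using ((hasDerivAt_id u).const_mul b).const_add x₀
    have h2 := (hyc.differentiable (by simp) u).hasDerivAt
    have h3 : HasDerivAt (fun u : ℝ => a * u - y x₀) a u := by
      simpa using ((hasDerivAt_id u).const_mul a).sub_const (y x₀)
    have h4 : deriv v u = deriv (fun u : ℝ => y (x₀ + b * u)) u + a := (h2.add h3).deriv
    convert h1.prodMk h2 using 1
    rw [h4, hw]
    ext <;> simp
  have hgγ : ∀ᶠ u in 𝓝 (0 : ℝ), g.1 (γ u) = 0 := by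
    have : Tendsto (fun u : ℝ => x₀ + b * u) (𝓝 0) (𝓝 x₀) := by
      simpa using hline.continuous.tendsto 0
    exact this.eventually himp
  have hg0 : g.1 (x₀, y x₀) = 0 := himp.self_of_nhds
  have hgw : (dirDeriv w g : smoothFun).1 (x₀, y x₀) = 0 := by
    rw [hw, dirDeriv_add_smul]
    change b * (dirDeriv (1, 0) g : smoothFun).1 (x₀, y x₀) +
      -a * (dirDeriv (0, 1) g : smoothFun).1 (x₀, y x₀) = 0
    rw [ha, hb]
    ring
  set B : ℕ × ℕ → ℝ := fun p => ((dirDeriv w ^ p.1 * dirDeriv (0, 1) ^ p.2) g :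
    smoothFun).1 (x₀, y x₀) / (p.1.factorial * p.2.factorial) with hB
  have hB00 : B (0, 0) = 0 := by simp [hB, hg0]
  have hB10 : B (1, 0) = 0 := by simp [hB, hgw]
  have hB01 : B (0, 1) = b := by simp [hB, hb]
  have hcoeff : ∀ (n k : ℕ) (p : ℕ × ℕ),
      taylorCoeff n (fun u => v u ^ (k - 1) * (u ^ p.1 * v u ^ p.2)) =
        if p.1 ≤ n then taylorCoeff (n - p.1) (fun u => v u ^ (k - 1 + p.2)) else 0 := by
    intro n k p
    rw [← taylorCoeff_pow_mul _ _ (hv.pow _)]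
    congr 1
    funext u
    ring
  have hrec : ∀ N ≤ n, ∀ k, 1 ≤ k → taylorCoeff N (fun u => v u ^ k) =
      ∑ i ∈ I with i.1 ≤ N, -(B i) / b * taylorCoeff (N - i.1) (fun u => v u ^ (k - 1 + i.2)) := by
    intro N hN k hk
    have hz : taylorCoeff N (fun u => v u ^ (k - 1) * g.1 (γ u)) = 0 := by
      rw [← taylorCoeff_const_zero N]
      refine taylorCoeff_congr N ?_
      filter_upwards [hgγ] with u hu
      rw [hu, mul_zero]
    rw [taylorCoeff_mul_comp (e := (0, 1)) hv hv0 hγ hγ' N (hN.trans_lt hL) (hN.trans_lt hL) g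
      (hv.pow (k - 1)), hγ0, ← Finset.sum_product'] at hz
    replace hz : ∑ p ∈ Finset.range L ×ˢ Finset.range L, B p *
        (if p.1 ≤ N then taylorCoeff (N - p.1) (fun u => v u ^ (k - 1 + p.2)) else 0) = 0 := by
      refine (Finset.sum_congr rfl fun p _ => ?_).trans hz
      rw [← hcoeff N k p]
    rw [← Finset.sum_filter_add_sum_filter_not _ (fun p : ℕ × ℕ => 2 ≤ p.1 + p.2), ← hI,
      Finset.sum_eq_single_of_mem (s := Finset.filter (fun p : ℕ × ℕ => ¬ 2 ≤ p.1 + p.2) _) (0, 1)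
        (by simp; omega), hB01] at hz
    · simp only [zero_le, if_true, Nat.sub_zero, Nat.sub_add_cancel hk] at hz
      rw [Finset.sum_filter, ← mul_right_inj' hb0, eq_neg_of_add_eq_zero_right hz, Finset.mul_sum,
        ← Finset.sum_neg_distrib]
      refine Finset.sum_congr rfl fun i _ => ?_
      split_ifs
      · field_simp
      · simp
    · rintro ⟨l, r⟩ hp hne
      have hlr : l + r < 2 := by simpa using (Finset.mem_filter.1 hp).2
      obtain ⟨rfl, rfl⟩ | ⟨rfl, rfl⟩ : (l = 0 ∧ r = 0) ∨ (l = 1 ∧ r = 0) := by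
        have : ¬ (l = 0 ∧ r = 1) := by
          rintro ⟨rfl, rfl⟩
          exact hne rfl
        omega
      · rw [hB00, zero_mul]
      · rw [hB10, zero_mul]
  have hlag := eq_sum_lagrangeTerm (I := I) (fun p hp => (Finset.mem_filter.1 hp).2)
    (fun p => -(B p) / b) (fun N k => taylorCoeff N (fun u => v u ^ k)) n
    (fun N => by simpa using taylorCoeff_one N)
    (fun N k hNk => by
      simpa using taylorCoeff_mul_pow_eq_zero hv hv0 hNk (contDiff_const (c := (1 : ℝ))))
    hrec n 1 le_rfl
  rw [← hlag]
  have hlin : taylorCoeff n (fun u => a * u - y x₀) = 0 := by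
    obtain ⟨N, rfl⟩ := Nat.exists_eq_add_of_le' hn
    have h1 : deriv (fun u : ℝ => a * u - y x₀) = fun _ => a := by
      funext u
      simp
    rw [taylorCoeff_succ, taylorCoeff_succ, h1]
    simp [taylorCoeff_const_zero]
  have hvn : taylorCoeff n (fun u => v u ^ 1) = b ^ n * iteratedDeriv n y x₀ / n.factorial := by
    simp only [pow_one]
    rw [taylorCoeff_add n hyc (by fun_prop), hlin, add_zero, taylorCoeff]
    have h1 : ContDiff ℝ n fun z : ℝ => y (x₀ + z) :=
      (hy.comp (contDiff_const.add contDiff_id)).of_le (mod_cast le_top)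
    rw [iteratedDeriv_comp_const_mul h1 b]
    simp [iteratedDeriv_comp_const_add]
  have hfac : (n.factorial : ℝ) ≠ 0 := by positivity
  rw [hvn]
  field_simp

theorem Amem_iff_mem_profiles {n L : ℕ} (hL : n + 1 ≤ L) (m : (ℕ × ℕ) →₀ ℕ) :
    Amem n m ↔ m ∈ profiles
      ((Finset.range L ×ˢ Finset.range L).filter fun p => 2 ≤ p.1 + p.2) n 1 := by
  rw [mem_profiles fun p hp => (Finset.mem_filter.1 hp).2]
  have h1 : Finsupp.weight Prod.fst m = m.sum fun p k => p.1 * k := by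
    simp [Finsupp.weight_apply, mul_comm]
  have h2 : Finsupp.weight Prod.snd m = m.sum fun p k => p.2 * k := by
    simp [Finsupp.weight_apply, mul_comm]
  have h3 : m.degree = m.sum fun _ k => k := rfl
  rw [h1, h2, h3, Amem]
  refine ⟨fun ⟨hs, hn, hr⟩ => ⟨fun q hq => ?_, hn, hr⟩,
    fun ⟨hs, hn, hr⟩ => ⟨fun p hp => (Finset.mem_filter.1 (hs hp)).2, hn, hr⟩⟩
  have hle : q.1 + q.2 - 1 ≤ ∑ p ∈ m.support, (p.1 + p.2 - 1) * m p :=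
    (Nat.le_mul_of_pos_right _ (Nat.pos_of_ne_zero (Finsupp.mem_support_iff.1 hq))).trans
      (Finset.single_le_sum (f := fun p : ℕ × ℕ => (p.1 + p.2 - 1) * m p)
        (fun _ _ => Nat.zero_le _) hq)
  have hsum : ∑ p ∈ m.support, (p.1 + p.2 - 1) * m p + (m.sum fun _ k => k) =
      (m.sum fun p k => p.1 * k) + m.sum fun p k => p.2 * k := by
    simp only [Finsupp.sum, ← Finset.sum_add_distrib]
    refine Finset.sum_congr rfl fun p hp => ?_
    obtain ⟨s, hs'⟩ := Nat.exists_eq_add_of_le (hs p hp)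
    rw [← add_mul, hs', show 2 + s - 1 = s + 1 by omega]
    ring
  have := hs q hq
  simp only [Finset.mem_filter, Finset.mem_product, Finset.mem_range]
  omega

theorem statement12 (f : ℝ → ℝ → ℝ) (x₀ y₀ : ℝ) (y : ℝ → ℝ)
    (hf : ∀ᶠ p in 𝓝 (x₀, y₀), ContDiffAt ℝ (⊤ : ℕ∞) (Function.uncurry f) p)
    (hf0 : f x₀ y₀ = 0) (hfy : pd f 0 1 x₀ y₀ ≠ 0)
    (hy : ∀ᶠ x in 𝓝 x₀, ContDiffAt ℝ (⊤ : ℕ∞) y x)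
    (hy0 : y x₀ = y₀)
    (himp : ∀ᶠ x in 𝓝 x₀, f x (y x) = 0)
    (n : ℕ) (hn : 2 ≤ n) :
    iteratedDeriv n y x₀ =
      ∑ᶠ m ∈ {m : (ℕ × ℕ) →₀ ℕ | Amem n m},
        ((-1 : ℝ) ^ (m.sum fun _ k => k) * (n.factorial : ℝ) *
            ((m.sum fun p k => p.2 * k).factorial : ℝ) /
          (m.prod fun p k =>
            (p.1.factorial : ℝ) ^ k * (p.2.factorial : ℝ) ^ k * (k.factorial : ℝ))) *
        (m.prod fun p k => (Delta f p.1 (pd f 0 p.2) x₀ y₀) ^ k) /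
        (pd f 0 1 x₀ y₀) ^ (n + m.sum fun _ k => k) := by
  obtain ⟨F, hF, hFf⟩ := exists_contDiff_eventuallyEq hf
  obtain ⟨Y, hY, hYy⟩ := exists_contDiff_eventuallyEq hy
  let g : smoothFun := ⟨F, hF⟩
  let f' : ℝ → ℝ → ℝ := fun x y => g.1 (x, y)
  have hff' : ∀ᶠ q in 𝓝 (x₀, y₀), f q.1 q.2 = f' q.1 q.2 := by
    filter_upwards [hFf] with q hq
    exact hq.symm
  have hpd : ∀ p r, pd f p r x₀ y₀ = pd f' p r x₀ y₀ := fun p r =>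
    (pd_eventually_congr hff' p r).self_of_nhds
  have hYx : Y x₀ = y₀ := hYy.self_of_nhds.trans hy0
  have himp' : ∀ᶠ x in 𝓝 x₀, g.1 (x, Y x) = 0 := by
    have ht : Tendsto (fun x => (x, Y x)) (𝓝 x₀) (𝓝 (x₀, y₀)) := by
      rw [← hYx]
      exact (continuous_id.prodMk hY.continuous).tendsto x₀
    filter_upwards [ht.eventually hFf, hYy, himp] with x h1 h2 h3
    change F (x, Y x) = 0
    rw [h1, Function.uncurry_apply_pair, h2, h3]
  have hDelta : ∀ p : ℕ × ℕ, Delta f p.1 (pd f 0 p.2) x₀ y₀ =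
      ((dirDeriv (pd f 0 1 x₀ y₀ • (1, 0) + (-pd f 1 0 x₀ y₀) • (0, 1)) ^ p.1 *
        dirDeriv (0, 1) ^ p.2) g : smoothFun).1 (x₀, y₀) := by
    intro p
    rw [Delta_congr hff' (pd_eventually_congr hff' 0 p.2), hpd, hpd]
    exact Delta_smoothFun g g p.1 p.2 x₀ y₀
  rw [← hYy.iteratedDeriv_eq, iteratedDeriv_implicit g hY himp' (a := pd f 1 0 x₀ y₀)
    (b := pd f 0 1 x₀ y₀) (by rw [hpd, pd_smoothFun, hYx]; simp)
    (by rw [hpd, pd_smoothFun, hYx]; simp) hfy hn (Nat.lt_succ_self n), hYx]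
  simp only [← hDelta]
  have hset : {m : (ℕ × ℕ) →₀ ℕ | Amem n m} = ↑(profiles
      ((Finset.range (n + 1) ×ˢ Finset.range (n + 1)).filter fun p => 2 ≤ p.1 + p.2) n 1) := by
    ext m
    exact Amem_iff_mem_profiles le_rfl m
  rw [hset, finsum_mem_coe_finset, Finset.mul_sum]
  refine Finset.sum_congr rfl fun m hm => ?_
  obtain ⟨-, -, hr⟩ := (Amem_iff_mem_profiles le_rfl m).2 hm
  have hm0 : m ≠ 0 := by
    rintro rfl
    simp at hr
  have hdeg : m.degree - 1 = m.sum fun p k => p.2 * k := by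
    change (m.sum fun _ k => k) - 1 = _
    omega
  rw [lagrangeTerm, if_neg hm0, hdeg]
  have hprod : divPowProd (fun p => -(Delta f p.1 (pd f 0 p.2) x₀ y₀ /
      (p.1.factorial * p.2.factorial)) / pd f 0 1 x₀ y₀) m =
      (-1) ^ (m.sum fun _ k => k) * (m.prod fun p k => (Delta f p.1 (pd f 0 p.2) x₀ y₀) ^ k) /
        ((m.prod fun p k =>
          (p.1.factorial : ℝ) ^ k * (p.2.factorial : ℝ) ^ k * (k.factorial : ℝ)) *
        (pd f 0 1 x₀ y₀) ^ (m.sum fun _ k => k)) := by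
    simp only [divPowProd, Finsupp.prod, Finsupp.sum, ← Finset.prod_pow_eq_pow_sum,
      ← Finset.prod_mul_distrib, ← Finset.prod_div_distrib]
    refine Finset.prod_congr rfl fun p _ => ?_
    rw [div_pow, neg_pow, div_pow, mul_pow]
    field_simp
  rw [hprod, pow_add]
  push_cast
  ring
end

section
/- Assume additionally that f_x(x₀, y₀) = 0. Then for every integer n ≥ 2, the n-th derivative of the implicit function at x₀ is y^{(n)}(x₀) = Σ_{α = (m_{l,r}) ∈ A_n} [(−1)^{Σ_{l+r≥2} m_{l,r}} · n! · (Σ_{l+r≥2} r·m_{l,r})! / ∏_{l+r≥2} (l!^{m_{l,r}} · r!^{m_{l,r}} · m_{l,r}!)] · [∏_{l+r≥2} (f_{x^l y^r}(x₀, y₀))^{m_{l,r}}] / f_y(x₀, y₀)^{Σ_{l+r≥2} m_{l,r}}. -/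
open Filter Topology

section FormalLagrange

open scoped LaurentPolynomial PowerSeries Polynomial
open PowerSeries (coeff constantCoeff derivative)
open LaurentPolynomial (T)

variable {K : Type*} [Field K]

/-- The coefficient of `X ^ j * T (-1)` in a power series over Laurent polynomials. -/
noncomputable def residueCoeff (K : Type*) [Field K] (j : ℕ) : K[T;T⁻¹]⟦X⟧ →ₗ[K] K where
  toFun p := (coeff j p).coeff (-1)
  map_add' p q := by simp
  map_smul' c p := by simp

theorem residueCoeff_apply (j : ℕ) (p : K[T;T⁻¹]⟦X⟧) :
    residueCoeff K j p = (coeff j p).coeff (-1) := rfl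

theorem residueCoeff_map_toLaurent (j : ℕ) (p : K[X]⟦X⟧) :
    residueCoeff K j (PowerSeries.map Polynomial.toLaurent p) = 0 := by
  rw [residueCoeff_apply, PowerSeries.coeff_map, LaurentPolynomial.coeff_toLaurent,
    Finsupp.mapDomain_of_notMem_range]
  rintro ⟨k, hk⟩
  simp at hk

theorem residueCoeff_map_C_mul_C_T (j : ℕ) (p : K⟦X⟧) (i : ℤ) :
    residueCoeff K j (PowerSeries.map LaurentPolynomial.C p * PowerSeries.C (T i)) =
      if i = -1 then coeff j p else 0 := by
  rw [residueCoeff_apply, PowerSeries.coeff_mul_C, PowerSeries.coeff_map,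
    ← LaurentPolynomial.single_eq_C_mul_T, AddMonoidAlgebra.coeff_single, Finsupp.single_apply]

theorem residueCoeff_derivative (j : ℕ) (p : K[T;T⁻¹]⟦X⟧) :
    residueCoeff K j (derivative _ p) = (j + 1) * residueCoeff K (j + 1) p := by
  have h : coeff j (derivative _ p) = ((j : K) + 1) • coeff (j + 1) p := by
    rw [PowerSeries.coeff_derivative, Algebra.smul_def, mul_comm]
    simp
  rw [residueCoeff_apply, residueCoeff_apply, h]
  simp

theorem residueCoeff_X_pow_mul_of_lt {j k : ℕ} (h : j < k) (p : K[T;T⁻¹]⟦X⟧) :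
    residueCoeff K j (PowerSeries.X ^ k * p) = 0 := by
  rw [residueCoeff_apply, PowerSeries.coeff_X_pow_mul', if_neg (by omega)]
  simp

/-- The residue of the logarithmic derivative of `1 - ψ`, as a sum over the powers of `ψ`. -/
theorem residueCoeff_derivative_mul_inverse [CharZero K] {ψ v : K[T;T⁻¹]⟦X⟧}
    (hψ : constantCoeff ψ = 0) (hv : (1 - ψ) * v = 1) {j k : ℕ} (hjk : j < k) :
    residueCoeff K j (derivative _ ψ * v) =
      (j + 1) * ∑ i ∈ Finset.range k, residueCoeff K (j + 1) (ψ ^ (i + 1)) / (i + 1) := by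
  have hgeom : v = ∑ i ∈ Finset.range k, ψ ^ i + ψ ^ k * v := by
    linear_combination (∑ i ∈ Finset.range k, ψ ^ i) * hv - v * mul_neg_geom_sum ψ k
  obtain ⟨q, hq⟩ := pow_dvd_pow_of_dvd (PowerSeries.X_dvd_iff.mpr hψ) k
  have hpow (i : ℕ) : derivative _ ψ * ψ ^ i =
      ((i : K) + 1)⁻¹ • derivative K[T;T⁻¹] (ψ ^ (i + 1)) := by
    rw [eq_inv_smul_iff₀ (Nat.cast_add_one_ne_zero i), PowerSeries.derivative_pow, Algebra.smul_def]
    simp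
    ring
  rw [hgeom, mul_add, map_add, hq, show derivative _ ψ * (PowerSeries.X ^ k * q * v) =
    PowerSeries.X ^ k * (derivative _ ψ * q * v) by ring, residueCoeff_X_pow_mul_of_lt hjk,
    add_zero, Finset.mul_sum, map_sum, Finset.mul_sum]
  refine Finset.sum_congr rfl fun i _ => ?_
  rw [hpow, map_smul, residueCoeff_derivative, smul_eq_mul]
  ring

/-- Lagrange inversion by residues: a factorization of `1 - ψ` into `1 - w / T` and a unit
without negative powers of `T` expresses `w` through the residues of the powers of `ψ`. -/
theorem coeff_eq_sum_residueCoeff [CharZero K] {ψ : K[T;T⁻¹]⟦X⟧} {w : K⟦X⟧} {g : K[X]⟦X⟧}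
    (hw : constantCoeff w = 0) (hg : constantCoeff g = 1)
    (hψ : constantCoeff ψ = 0)
    (h : 1 - ψ = (1 - PowerSeries.map LaurentPolynomial.C w * PowerSeries.C (T (-1))) *
      PowerSeries.map Polynomial.toLaurent g) {j k : ℕ} (hjk : j < k) :
    coeff (j + 1) w =
      ∑ i ∈ Finset.range k, residueCoeff K (j + 1) (ψ ^ (i + 1)) / (i + 1) := by
  set ω : K[T;T⁻¹]⟦X⟧ := PowerSeries.map LaurentPolynomial.C w * PowerSeries.C (T (-1)) with hω
  have hω0 : constantCoeff ω = 0 := by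
    rw [hω, map_mul, ← PowerSeries.coeff_zero_eq_constantCoeff_apply, PowerSeries.coeff_map]
    simp [hw]
  obtain ⟨s, hs⟩ := (PowerSeries.isUnit_iff_constantCoeff.mpr
    (by rw [hg]; exact isUnit_one) : IsUnit g).exists_right_inv
  obtain ⟨a, ha⟩ := (PowerSeries.isUnit_iff_constantCoeff.mpr
    (by simp [hψ]) : IsUnit (1 - ψ)).exists_right_inv
  obtain ⟨b, hb⟩ := (PowerSeries.isUnit_iff_constantCoeff.mpr
    (by simp [hω0]) : IsUnit (1 - ω)).exists_right_inv
  set φ := PowerSeries.map (Polynomial.toLaurent (R := K))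
  have hs' : φ g * φ s = 1 := by rw [← map_mul, hs, map_one]
  have hdg : derivative _ (φ g) = φ (derivative _ g) := by
    ext1 i
    simp [φ, PowerSeries.coeff_derivative]
  have hd : derivative _ ψ = derivative _ ω * φ g - (1 - ω) * φ (derivative _ g) := by
    have := congrArg (derivative _) h
    rw [Derivation.leibniz, hdg] at this
    simp only [map_sub, PowerSeries.derivative_one, smul_eq_mul] at this
    linear_combination -this
  have ha' : a = b * φ s := by
    calc a = a * ((1 - ω) * b) * (φ g * φ s) := by rw [hb, hs']; ring
      _ = ((1 - ω) * φ g * a) * (b * φ s) := by ring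
      _ = b * φ s := by rw [← h, ha, one_mul]
  have hlog : derivative _ ψ * a = derivative _ ω * b - φ (derivative _ g * s) := by
    rw [hd, ha', map_mul φ]
    linear_combination (derivative _ ω * b) * hs' - φ (derivative _ g) * φ s * hb
  have hres := congrArg (residueCoeff K j) hlog
  rw [map_sub, residueCoeff_map_toLaurent, sub_zero,
    residueCoeff_derivative_mul_inverse hψ ha hjk,
    residueCoeff_derivative_mul_inverse hω0 hb hjk] at hres
  rw [mul_left_cancel₀ (Nat.cast_add_one_ne_zero j) hres,
    Finset.sum_eq_single_of_mem 0 (by simp; omega)]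
  · rw [zero_add, pow_one, hω, residueCoeff_map_C_mul_C_T]
    simp
  · intro i _ hi
    rw [hω, mul_pow, ← map_pow, ← map_pow, LaurentPolynomial.T_pow, residueCoeff_map_C_mul_C_T,
      if_neg (by push_cast; omega), zero_div]

/-- The polynomial `∑ c (l, r) x ^ l y ^ r`, evaluated at `y = X * T` and divided by `X * T`. -/
noncomputable def scaledSeries (s : Finset (ℕ × ℕ)) (c : ℕ × ℕ → K) : K[T;T⁻¹]⟦X⟧ :=
  ∑ p ∈ s, PowerSeries.X ^ (p.1 + p.2 - 1) *
    PowerSeries.C (LaurentPolynomial.C (c p) * T ((p.2 : ℤ) - 1))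

theorem residueCoeff_scaledSeries_pow (s : Finset (ℕ × ℕ)) (c : ℕ × ℕ → K) (j k : ℕ) :
    residueCoeff K j (scaledSeries s c ^ k) =
      ∑ m ∈ s.piAntidiag k,
        if ∑ p ∈ s, m p * (p.1 + p.2 - 1) = j ∧ ∑ p ∈ s, (m p : ℤ) * ((p.2 : ℤ) - 1) = -1 then
          (Nat.multinomial s m : K) * ∏ p ∈ s, c p ^ m p else 0 := by
  have hT (t : Finset (ℕ × ℕ)) (b : ℕ × ℕ → ℤ) :
      ∏ p ∈ t, (T (b p) : K[T;T⁻¹]) = T (∑ p ∈ t, b p) := by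
    induction t using Finset.cons_induction with
    | empty => simp
    | cons a t ha ih => rw [Finset.prod_cons, Finset.sum_cons, ih, LaurentPolynomial.T_add]
  rw [scaledSeries, Finset.sum_pow_eq_sum_piAntidiag, map_sum]
  refine Finset.sum_congr rfl fun m _ => ?_
  have hprod : ∏ p ∈ s, (PowerSeries.X ^ (p.1 + p.2 - 1) *
      PowerSeries.C (LaurentPolynomial.C (c p) * T ((p.2 : ℤ) - 1)) : K[T;T⁻¹]⟦X⟧) ^ m p =
      PowerSeries.X ^ (∑ p ∈ s, m p * (p.1 + p.2 - 1)) *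
        PowerSeries.C (LaurentPolynomial.C (∏ p ∈ s, c p ^ m p) *
          T (∑ p ∈ s, (m p : ℤ) * ((p.2 : ℤ) - 1))) := by
    simp only [mul_pow, Finset.prod_mul_distrib, ← pow_mul, Finset.prod_pow_eq_pow_sum, ← map_pow,
      ← map_prod, LaurentPolynomial.T_pow, hT, mul_comm (_ - 1)]
  generalize ∏ p ∈ s, c p ^ m p = d at hprod ⊢
  rw [hprod, ← nsmul_eq_mul, map_nsmul, residueCoeff_apply, PowerSeries.coeff_X_pow_mul',
    PowerSeries.coeff_C, nsmul_eq_mul, ← LaurentPolynomial.single_eq_C_mul_T]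
  by_cases h₁ : ∑ p ∈ s, m p * (p.1 + p.2 - 1) = j
  · simp only [h₁, le_refl, if_true, Nat.sub_self, AddMonoidAlgebra.coeff_single,
      Finsupp.single_apply, true_and, mul_ite, mul_zero]
  · rw [if_neg (show ¬(_ ∧ _) from fun h => h₁ h.1)]
    split_ifs with h₂
    · omega
    · simp
    · simp

/-- Lagrange inversion for a power series solution `w` of `X * w = ∑ c (l, r) X ^ l (X * w) ^ r`
up to high order, in residue form. -/
theorem coeff_eq_sum_residueCoeff_scaledSeries [CharZero K] {s : Finset (ℕ × ℕ)}
    {c : ℕ × ℕ → K} (hs : ∀ p ∈ s, 2 ≤ p.1 + p.2) {w e : K⟦X⟧} (hw : constantCoeff w = 0)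
    {j k : ℕ} (hjk : j < k)
    (h : w = ∑ p ∈ s, PowerSeries.X ^ (p.1 + p.2 - 1) * PowerSeries.C (c p) * w ^ p.2 +
      PowerSeries.X ^ (j + 2) * e) :
    coeff (j + 1) w =
      ∑ i ∈ Finset.range k, residueCoeff K (j + 1) (scaledSeries s c ^ (i + 1)) / (i + 1) := by
  set ι : K⟦X⟧ →+* K[T;T⁻¹]⟦X⟧ := PowerSeries.map LaurentPolynomial.C with hι
  set ι' : K⟦X⟧ →+* K[X]⟦X⟧ := PowerSeries.map Polynomial.C
  set v : K[T;T⁻¹]⟦X⟧ := PowerSeries.C (T 1) with hv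
  set u : K[T;T⁻¹]⟦X⟧ := PowerSeries.C (T (-1)) with hu
  have huv : u * v = 1 := by
    rw [hu, hv, ← map_mul, ← LaurentPolynomial.T_add]; simp
  set ψ := scaledSeries s c + PowerSeries.X ^ (j + 2) * (ι e * u) with hψ
  set g : K[X]⟦X⟧ := 1 - ∑ p ∈ s, PowerSeries.X ^ (p.1 + p.2 - 1) *
    PowerSeries.C (Polynomial.C (c p)) *
    ∑ i ∈ Finset.range p.2, PowerSeries.C Polynomial.X ^ i * ι' w ^ (p.2 - 1 - i) with hg
  have hg0 : constantCoeff g = 1 := by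
    rw [hg, map_sub, map_one, map_sum, Finset.sum_eq_zero, sub_zero]
    intro p hp
    have := hs p hp
    rw [mul_assoc, map_mul, map_pow, PowerSeries.constantCoeff_X, zero_pow (by omega), zero_mul]
  have hψ0 : constantCoeff ψ = 0 := by
    rw [hψ, map_add, scaledSeries, map_sum, Finset.sum_eq_zero, zero_add]
    · simp
    intro p hp
    have := hs p hp
    rw [map_mul, map_pow, PowerSeries.constantCoeff_X, zero_pow (by omega), zero_mul]
  have hφg : PowerSeries.map Polynomial.toLaurent g =
      1 - ∑ p ∈ s, PowerSeries.X ^ (p.1 + p.2 - 1) *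
        PowerSeries.C (LaurentPolynomial.C (c p)) *
        ∑ i ∈ Finset.range p.2, v ^ i * ι w ^ (p.2 - 1 - i) := by
    have hcomp : PowerSeries.map Polynomial.toLaurent (ι' w) = ι w := by
      ext1 i
      simp [ι, ι']
    simp [hg, hcomp, hv]
  have hιw : ι w = ∑ p ∈ s, PowerSeries.X ^ (p.1 + p.2 - 1) *
      PowerSeries.C (LaurentPolynomial.C (c p)) * ι w ^ p.2 + PowerSeries.X ^ (j + 2) * ι e := by
    conv_lhs => rw [h]
    simp [ι]
  have hscaled : v * scaledSeries s c = ∑ p ∈ s, PowerSeries.X ^ (p.1 + p.2 - 1) *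
      PowerSeries.C (LaurentPolynomial.C (c p)) * v ^ p.2 := by
    rw [scaledSeries, Finset.mul_sum]
    refine Finset.sum_congr rfl fun p _ => ?_
    rw [hv, ← map_pow, LaurentPolynomial.T_pow, mul_assoc _ _ (PowerSeries.C _), ← map_mul,
      mul_left_comm, ← map_mul, mul_left_comm, ← LaurentPolynomial.T_add]
    congr 4
    ring
  have hdiff : (v - ι w) * ∑ p ∈ s, PowerSeries.X ^ (p.1 + p.2 - 1) *
        PowerSeries.C (LaurentPolynomial.C (c p)) *
        ∑ i ∈ Finset.range p.2, v ^ i * ι w ^ (p.2 - 1 - i) =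
      ∑ p ∈ s, PowerSeries.X ^ (p.1 + p.2 - 1) *
        PowerSeries.C (LaurentPolynomial.C (c p)) * v ^ p.2 -
      ∑ p ∈ s, PowerSeries.X ^ (p.1 + p.2 - 1) *
        PowerSeries.C (LaurentPolynomial.C (c p)) * ι w ^ p.2 := by
    rw [Finset.mul_sum, ← Finset.sum_sub_distrib]
    refine Finset.sum_congr rfl fun p _ => ?_
    rw [← mul_sub, ← (Commute.all v (ι w)).mul_geom_sum₂]
    ring
  have hfac : 1 - ψ = (1 - ι w * u) * PowerSeries.map Polynomial.toLaurent g := by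
    have : v * (1 - ψ) = (v - ι w) * PowerSeries.map Polynomial.toLaurent g := by
      rw [hφg, mul_sub (v - ι w), hdiff, ← hscaled, hψ]
      linear_combination hιw - PowerSeries.X ^ (j + 2) * ι e * huv
    calc 1 - ψ = u * (v * (1 - ψ)) + (1 - u * v) * (1 - ψ) := by ring
      _ = _ := by rw [this, huv]; linear_combination huv * PowerSeries.map Polynomial.toLaurent g
  rw [coeff_eq_sum_residueCoeff hw hg0 hψ0 hfac hjk]
  refine Finset.sum_congr rfl fun i _ => ?_
  obtain ⟨q, hq⟩ : PowerSeries.X ^ (j + 2) ∣ ψ ^ (i + 1) - scaledSeries s c ^ (i + 1) :=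
    (Dvd.intro (ι e * u) (by rw [hψ]; ring : _ = ψ - scaledSeries s c)).trans
      (sub_dvd_pow_sub_pow _ _ _)
  rw [eq_add_of_sub_eq hq, map_add, residueCoeff_X_pow_mul_of_lt (by omega), zero_add]

/-- Lagrange inversion for a power series solution `w` of `X * w = ∑ c (l, r) X ^ l (X * w) ^ r`
up to high order. -/
theorem coeff_eq_finsum_Amem [CharZero K] {s : Finset (ℕ × ℕ)}
    {c : ℕ × ℕ → K} (hs : ∀ p ∈ s, 2 ≤ p.1 + p.2) {w e : K⟦X⟧} (hw : constantCoeff w = 0)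
    {j : ℕ} (hsupp : ∀ m, Amem (j + 2) m → m.support ⊆ s)
    (h : w = ∑ p ∈ s, PowerSeries.X ^ (p.1 + p.2 - 1) * PowerSeries.C (c p) * w ^ p.2 +
      PowerSeries.X ^ (j + 2) * e) :
    coeff (j + 1) w =
      ∑ᶠ m ∈ {m : (ℕ × ℕ) →₀ ℕ | Amem (j + 2) m},
        ((m.sum fun p k => p.2 * k).factorial : K) / (m.prod fun _ k => (k.factorial : K)) *
          m.prod fun p k => c p ^ k := by
  classical
  have hrel {m : (ℕ × ℕ) →₀ ℕ} (hm : m.support ⊆ s) :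
      ∑ p ∈ s, m p * (p.1 + p.2 - 1) + ∑ p ∈ s, m p =
        ∑ p ∈ s, p.1 * m p + ∑ p ∈ s, p.2 * m p := by
    rw [← Finset.sum_add_distrib, ← Finset.sum_add_distrib]
    refine Finset.sum_congr rfl fun p hp => ?_
    have := hs p hp
    obtain ⟨t, ht⟩ : ∃ t, p.1 + p.2 = t + 1 := ⟨p.1 + p.2 - 1, by omega⟩
    rw [← add_mul, ht, Nat.add_sub_cancel]
    ring
  have hAmem {m : (ℕ × ℕ) →₀ ℕ} (hm : m.support ⊆ s) : Amem (j + 2) m ↔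
      ∑ p ∈ s, p.1 * m p = j + 2 ∧ ∑ p ∈ s, p.2 * m p + 1 = ∑ p ∈ s, m p := by
    rw [Amem, Finsupp.sum_of_support_subset m hm _ (by simp),
      Finsupp.sum_of_support_subset m hm _ (by simp),
      Finsupp.sum_of_support_subset m hm _ (by simp)]
    exact and_iff_right fun p hp => hs p (hm hp)
  have hset : {m : (ℕ × ℕ) →₀ ℕ | Amem (j + 2) m} =
      (((Finset.range (j + 1)).biUnion fun i => s.finsuppAntidiag (i + 1)).filter
        (Amem (j + 2)) : Finset _) := by
    ext m
    simp only [Set.mem_ofPred_eq, Finset.coe_filter, Finset.mem_biUnion, Finset.mem_range,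
      Finset.mem_finsuppAntidiag]
    refine ⟨fun hm => ⟨⟨m.sum fun p k => p.2 * k, ?_, ?_, hsupp m hm⟩, hm⟩, fun hm => hm.2⟩
    all_goals
      have h₁ := hrel (hsupp m hm)
      have h₂ := (hAmem (hsupp m hm)).mp hm
      rw [Finsupp.sum_of_support_subset m (hsupp m hm) _ (by simp)]
    · have h₃ : ∑ p ∈ s, m p ≤ ∑ p ∈ s, m p * (p.1 + p.2 - 1) :=
        Finset.sum_le_sum fun p hp => Nat.le_mul_of_pos_right _ (by have := hs p hp; omega)
      omega
    · exact h₂.2.symm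
  rw [coeff_eq_sum_residueCoeff_scaledSeries hs hw (Nat.lt_succ_self j) h, hset,
    finsum_mem_coe_finset, Finset.sum_filter, Finset.sum_biUnion]
  · refine Finset.sum_congr rfl fun i _ => ?_
    rw [residueCoeff_scaledSeries_pow, Finset.sum_div]
    refine (Finset.sum_nbij (fun m : (ℕ × ℕ) →₀ ℕ => (m : ℕ × ℕ → ℕ)) ?_
      DFunLike.coe_injective.injOn ?_ ?_).symm
    · intro m hm
      rw [Finset.mem_finsuppAntidiag] at hm
      exact Finset.mem_piAntidiag.mpr ⟨hm.1, fun p hp => hm.2 (Finsupp.mem_support_iff.mpr hp)⟩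
    · intro m hm
      have hm' := Finset.mem_piAntidiag.mp hm
      refine ⟨Finsupp.onFinset s m hm'.2, ?_, rfl⟩
      exact Finset.mem_finsuppAntidiag.mpr ⟨hm'.1, Finsupp.support_onFinset_subset⟩
    · intro m hm
      rw [Finset.mem_finsuppAntidiag] at hm
      obtain ⟨hsum, hms⟩ := hm
      replace hsum : ∑ p ∈ s, m p = i + 1 := hsum
      have h₁ := hrel hms
      have h₂ : ∑ p ∈ s, (m p : ℤ) * ((p.2 : ℤ) - 1) =
          ((∑ p ∈ s, p.2 * m p : ℕ) : ℤ) - (∑ p ∈ s, m p : ℕ) := by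
        push_cast
        rw [← Finset.sum_sub_distrib]
        exact Finset.sum_congr rfl fun p _ => by ring
      by_cases hA : Amem (j + 2) m
      · have h₃ := (hAmem hms).mp hA
        have hi : ∑ p ∈ s, p.2 * m p = i := by omega
        have hcond : ∑ p ∈ s, m p * (p.1 + p.2 - 1) = j + 1 ∧
            ∑ p ∈ s, (m p : ℤ) * ((p.2 : ℤ) - 1) = -1 := ⟨by omega, by omega⟩
        rw [if_pos hA, if_pos hcond, Finsupp.sum_of_support_subset m hms _ (by simp),
          Finsupp.prod_of_support_subset m hms _ (by simp),
          Finsupp.prod_of_support_subset m hms _ (by simp), hi]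
        have hmul : (∏ p ∈ s, ((m p).factorial : K)) * (Nat.multinomial s m : K) =
            (i + 1) * (i.factorial : K) := by
          have := Nat.multinomial_spec s m
          rw [hsum, Nat.factorial_succ] at this
          exact_mod_cast this
        have hne : ∏ p ∈ s, ((m p).factorial : K) ≠ 0 :=
          Finset.prod_ne_zero_iff.mpr fun p _ => Nat.cast_ne_zero.mpr (Nat.factorial_ne_zero _)
        have hne' := Nat.cast_add_one_ne_zero (R := K) i
        field_simp
        linear_combination -(∏ p ∈ s, c p ^ m p) * hmul
      · rw [if_neg hA, if_neg, zero_div]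
        intro hcon
        exact hA ((hAmem hms).mpr (by omega))
  · intro a _ b _ hab
    refine Finset.disjoint_left.mpr fun m hma hmb => hab ?_
    have h₁ := (Finset.mem_finsuppAntidiag.mp hma).1
    have h₂ := (Finset.mem_finsuppAntidiag.mp hmb).1
    omega

end FormalLagrange

section PartialDerivatives

theorem pd_zero_zero (f : ℝ → ℝ → ℝ) : pd f 0 0 = f := by
  funext x y
  simp [pd]

theorem pd_succ_left (f : ℝ → ℝ → ℝ) (p r : ℕ) (x y : ℝ) :
    pd f (p + 1) r x y = deriv (fun x' => pd f p r x' y) x := by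
  rw [pd, iteratedDeriv_succ]
  rfl

theorem pd_zero_succ (f : ℝ → ℝ → ℝ) (r : ℕ) (x y : ℝ) :
    pd f 0 (r + 1) x y = deriv (fun y' => pd f 0 r x y') y := by
  simp only [pd, iteratedDeriv_zero]
  rw [iteratedDeriv_succ]

variable {U : Set (ℝ × ℝ)} {g : ℝ → ℝ → ℝ}

theorem deriv_fst_eq_fderiv {x y : ℝ} (hg : DifferentiableAt ℝ (Function.uncurry g) (x, y)) :
    deriv (fun x' => g x' y) x = fderiv ℝ (Function.uncurry g) (x, y) (1, 0) :=
  (hg.hasFDerivAt.comp_hasDerivAt (f := fun x' => (x', y)) x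
    ((hasDerivAt_id x).prodMk (hasDerivAt_const x y))).deriv

theorem deriv_snd_eq_fderiv {x y : ℝ} (hg : DifferentiableAt ℝ (Function.uncurry g) (x, y)) :
    deriv (fun y' => g x y') y = fderiv ℝ (Function.uncurry g) (x, y) (0, 1) :=
  (hg.hasFDerivAt.comp_hasDerivAt (f := fun y' => (x, y')) y
    ((hasDerivAt_const y x).prodMk (hasDerivAt_id y))).deriv

theorem uncurry_deriv_fst_eventuallyEq (hU : IsOpen U)
    (hg : ∀ q ∈ U, ContDiffAt ℝ (⊤ : ℕ∞) (Function.uncurry g) q) {q : ℝ × ℝ} (hq : q ∈ U) :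
    Function.uncurry (fun x y => deriv (fun x' => g x' y) x) =ᶠ[𝓝 q]
      fun q => fderiv ℝ (Function.uncurry g) q (1, 0) := by
  filter_upwards [hU.mem_nhds hq] with q' hq'
  exact deriv_fst_eq_fderiv ((hg q' hq').differentiableAt (by simp))

theorem uncurry_deriv_snd_eventuallyEq (hU : IsOpen U)
    (hg : ∀ q ∈ U, ContDiffAt ℝ (⊤ : ℕ∞) (Function.uncurry g) q) {q : ℝ × ℝ} (hq : q ∈ U) :
    Function.uncurry (fun x y => deriv (fun y' => g x y') y) =ᶠ[𝓝 q]
      fun q => fderiv ℝ (Function.uncurry g) q (0, 1) := by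
  filter_upwards [hU.mem_nhds hq] with q' hq'
  exact deriv_snd_eq_fderiv ((hg q' hq').differentiableAt (by simp))

theorem contDiffAt_deriv_fst (hU : IsOpen U)
    (hg : ∀ q ∈ U, ContDiffAt ℝ (⊤ : ℕ∞) (Function.uncurry g) q) {q : ℝ × ℝ} (hq : q ∈ U) :
    ContDiffAt ℝ (⊤ : ℕ∞) (Function.uncurry fun x y => deriv (fun x' => g x' y) x) q :=
  (((hg q hq).fderiv_right (m := (⊤ : ℕ∞)) (by simp)).clm_apply
    contDiffAt_const).congr_of_eventuallyEq (uncurry_deriv_fst_eventuallyEq hU hg hq)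

theorem contDiffAt_deriv_snd (hU : IsOpen U)
    (hg : ∀ q ∈ U, ContDiffAt ℝ (⊤ : ℕ∞) (Function.uncurry g) q) {q : ℝ × ℝ} (hq : q ∈ U) :
    ContDiffAt ℝ (⊤ : ℕ∞) (Function.uncurry fun x y => deriv (fun y' => g x y') y) q :=
  (((hg q hq).fderiv_right (m := (⊤ : ℕ∞)) (by simp)).clm_apply
    contDiffAt_const).congr_of_eventuallyEq (uncurry_deriv_snd_eventuallyEq hU hg hq)

theorem deriv_snd_deriv_fst_comm (hU : IsOpen U)
    (hg : ∀ q ∈ U, ContDiffAt ℝ (⊤ : ℕ∞) (Function.uncurry g) q) {x y : ℝ} (hq : (x, y) ∈ U) :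
    deriv (fun y' => deriv (fun x' => g x' y') x) y =
      deriv (fun x' => deriv (fun y' => g x' y') y) x := by
  have hd : DifferentiableAt ℝ (fderiv ℝ (Function.uncurry g)) (x, y) :=
    ((hg _ hq).fderiv_right (m := (⊤ : ℕ∞)) (by simp)).differentiableAt (by simp)
  have hsymm : IsSymmSndFDerivAt ℝ (Function.uncurry g) (x, y) :=
    (hg _ hq).isSymmSndFDerivAt (by
      rw [minSmoothness_of_isRCLikeNormedField]
      exact WithTop.coe_le_coe.mpr (le_top : (2 : ℕ∞) ≤ ⊤))
  rw [deriv_snd_eq_fderiv (g := fun x y => deriv (fun x' => g x' y) x)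
      ((contDiffAt_deriv_fst hU hg hq).differentiableAt (by simp)),
    deriv_fst_eq_fderiv (g := fun x y => deriv (fun y' => g x y') y)
      ((contDiffAt_deriv_snd hU hg hq).differentiableAt (by simp)),
    (uncurry_deriv_fst_eventuallyEq hU hg hq).fderiv_eq,
    (uncurry_deriv_snd_eventuallyEq hU hg hq).fderiv_eq,
    fderiv_clm_apply hd (differentiableAt_const _), fderiv_clm_apply hd (differentiableAt_const _)]
  simpa using hsymm (0, 1) (1, 0)

variable {f : ℝ → ℝ → ℝ}

theorem contDiffAt_pd (hU : IsOpen U)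
    (hf : ∀ q ∈ U, ContDiffAt ℝ (⊤ : ℕ∞) (Function.uncurry f) q) (p r : ℕ) :
    ∀ q ∈ U, ContDiffAt ℝ (⊤ : ℕ∞) (Function.uncurry (pd f p r)) q := by
  induction p with
  | zero =>
    induction r with
    | zero => rwa [pd_zero_zero]
    | succ r ih =>
      intro q hq
      rw [show pd f 0 (r + 1) = fun x y => deriv (fun y' => pd f 0 r x y') y from
        funext fun x => funext fun y => pd_zero_succ f r x y]
      exact contDiffAt_deriv_snd hU ih hq
  | succ p ih =>
    intro q hq
    rw [show pd f (p + 1) r = fun x y => deriv (fun x' => pd f p r x' y) x from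
      funext fun x => funext fun y => pd_succ_left f p r x y]
    exact contDiffAt_deriv_fst hU ih hq

theorem pd_succ_right (hU : IsOpen U)
    (hf : ∀ q ∈ U, ContDiffAt ℝ (⊤ : ℕ∞) (Function.uncurry f) q) (p r : ℕ) {x y : ℝ}
    (hq : (x, y) ∈ U) :
    pd f p (r + 1) x y = deriv (fun y' => pd f p r x y') y := by
  induction p generalizing x with
  | zero => exact pd_zero_succ f r x y
  | succ p ih =>
    have hnear : ∀ᶠ x' in 𝓝 x, (x', y) ∈ U :=
      (continuous_id.prodMk continuous_const).continuousAt.eventually_mem (hU.mem_nhds hq)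
    simp only [pd_succ_left]
    rw [deriv_snd_deriv_fst_comm hU (contDiffAt_pd hU hf p r) hq]
    exact EventuallyEq.deriv_eq (hnear.mono fun x' hx' => ih hx')

theorem deriv_pd_comp (hU : IsOpen U)
    (hf : ∀ q ∈ U, ContDiffAt ℝ (⊤ : ℕ∞) (Function.uncurry f) q) (p r : ℕ) {y : ℝ → ℝ} {x : ℝ}
    (hq : (x, y x) ∈ U) (hy : DifferentiableAt ℝ y x) :
    deriv (fun x => pd f p r x (y x)) x =
      pd f (p + 1) r x (y x) + pd f p (r + 1) x (y x) * deriv y x := by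
  have hd := (contDiffAt_pd hU hf p r _ hq).differentiableAt (by simp)
  rw [pd_succ_left, pd_succ_right hU hf p r hq, deriv_fst_eq_fderiv hd, deriv_snd_eq_fderiv hd]
  refine (hd.hasFDerivAt.comp_hasDerivAt (f := fun x => (x, y x)) x
    ((hasDerivAt_id x).prodMk hy.hasDerivAt)).deriv.trans ?_
  rw [mul_comm, ← smul_eq_mul, ← map_smul, ← map_add]
  simp

end PartialDerivatives

section TaylorSeries

open scoped PowerSeries
open PowerSeries (coeff constantCoeff derivative)

/-- The formal Taylor series of a function of one real variable. -/
noncomputable def taylorPowerSeries (g : ℝ → ℝ) (x₀ : ℝ) : ℝ⟦X⟧ :=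
  PowerSeries.mk fun n => iteratedDeriv n g x₀ / n.factorial

variable {g h : ℝ → ℝ} {x₀ : ℝ}

theorem constantCoeff_taylorPowerSeries : constantCoeff (taylorPowerSeries g x₀) = g x₀ := by
  simp [taylorPowerSeries]

theorem taylorPowerSeries_congr (hgh : g =ᶠ[𝓝 x₀] h) :
    taylorPowerSeries g x₀ = taylorPowerSeries h x₀ := by
  ext n
  simp [taylorPowerSeries, hgh.iteratedDeriv_eq n]

theorem taylorPowerSeries_add (hg : ContDiffAt ℝ (⊤ : ℕ∞) g x₀)
    (hh : ContDiffAt ℝ (⊤ : ℕ∞) h x₀) :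
    taylorPowerSeries (fun x => g x + h x) x₀ =
      taylorPowerSeries g x₀ + taylorPowerSeries h x₀ := by
  ext n
  simp only [taylorPowerSeries, PowerSeries.coeff_mk, map_add]
  rw [iteratedDeriv_fun_add (hg.of_le (by exact_mod_cast le_top))
    (hh.of_le (by exact_mod_cast le_top)), add_div]

theorem taylorPowerSeries_mul (hg : ContDiffAt ℝ (⊤ : ℕ∞) g x₀)
    (hh : ContDiffAt ℝ (⊤ : ℕ∞) h x₀) :
    taylorPowerSeries (fun x => g x * h x) x₀ =
      taylorPowerSeries g x₀ * taylorPowerSeries h x₀ := by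
  ext n
  rw [PowerSeries.coeff_mul, Finset.Nat.sum_antidiagonal_eq_sum_range_succ_mk]
  simp only [taylorPowerSeries, PowerSeries.coeff_mk]
  rw [iteratedDeriv_fun_mul (hg.of_le (by exact_mod_cast le_top))
    (hh.of_le (by exact_mod_cast le_top)), Finset.sum_div]
  refine Finset.sum_congr rfl fun i hi => ?_
  rw [Nat.cast_choose ℝ (by simpa [Nat.lt_succ_iff] using hi)]
  have := Nat.factorial_ne_zero n
  field_simp

theorem derivative_taylorPowerSeries :
    derivative ℝ (taylorPowerSeries g x₀) = taylorPowerSeries (deriv g) x₀ := by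
  ext n
  rw [PowerSeries.coeff_derivative]
  simp only [taylorPowerSeries, PowerSeries.coeff_mk]
  rw [iteratedDeriv_succ', Nat.factorial_succ]
  push_cast
  field_simp

theorem X_pow_succ_dvd_of_X_pow_dvd_derivative {φ : ℝ⟦X⟧} {i : ℕ} (hφ : constantCoeff φ = 0)
    (h : PowerSeries.X ^ i ∣ derivative ℝ φ) : PowerSeries.X ^ (i + 1) ∣ φ := by
  rw [PowerSeries.X_pow_dvd_iff] at h ⊢
  rintro (_ | m) hm
  · simpa using hφ
  · have := h m (by omega)
    rw [PowerSeries.coeff_derivative] at this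
    exact (mul_eq_zero.mp this).resolve_right (Nat.cast_add_one_ne_zero m)

/-- The divided power `φ ^ k / k!`. -/
noncomputable def dividedPow (φ : ℝ⟦X⟧) (k : ℕ) : ℝ⟦X⟧ :=
  PowerSeries.C ((k.factorial : ℝ)⁻¹) * φ ^ k

theorem dividedPow_zero (φ : ℝ⟦X⟧) : dividedPow φ 0 = 1 := by
  simp [dividedPow]

theorem derivative_dividedPow_succ (φ : ℝ⟦X⟧) (k : ℕ) :
    derivative ℝ (dividedPow φ (k + 1)) = dividedPow φ k * derivative ℝ φ := by
  have hC : PowerSeries.C (((k + 1).factorial : ℝ)⁻¹) * ((k + 1 : ℕ) : ℝ⟦X⟧) =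
      PowerSeries.C ((k.factorial : ℝ)⁻¹) := by
    rw [← map_natCast PowerSeries.C, ← map_mul, Nat.factorial_succ]
    congr 1
    push_cast
    field_simp
  rw [dividedPow, dividedPow, Derivation.leibniz, PowerSeries.derivative_C,
    PowerSeries.derivative_pow, smul_zero, add_zero, smul_eq_mul, ← hC, Nat.add_sub_cancel]
  ring

theorem X_pow_dvd_dividedPow {φ : ℝ⟦X⟧} (hφ : constantCoeff φ = 0) (k : ℕ) :
    PowerSeries.X ^ k ∣ dividedPow φ k :=
  (pow_dvd_pow_of_dvd (PowerSeries.X_dvd_iff.mpr hφ) k).mul_left _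

/-- The Taylor polynomial with derivatives `a`, shifted by `(p, r)`, evaluated at `(X, φ)`. -/
noncomputable def taylorBox (a : ℕ → ℕ → ℝ) (φ : ℝ⟦X⟧) (M p r : ℕ) : ℝ⟦X⟧ :=
  ∑ k ∈ Finset.range (M + 1), ∑ l ∈ Finset.range (M + 1),
    PowerSeries.C (a (p + k) (r + l)) * (dividedPow PowerSeries.X k * dividedPow φ l)

theorem constantCoeff_taylorBox (a : ℕ → ℕ → ℝ) {φ : ℝ⟦X⟧} (hφ : constantCoeff φ = 0)
    (M p r : ℕ) : constantCoeff (taylorBox a φ M p r) = a p r := by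
  simp [taylorBox, dividedPow, hφ, Finset.sum_range_succ']

theorem X_pow_dvd_derivative_taylorBox_sub (a : ℕ → ℕ → ℝ) {φ : ℝ⟦X⟧}
    (hφ : constantCoeff φ = 0) (M p r : ℕ) :
    PowerSeries.X ^ M ∣ taylorBox a φ M (p + 1) r + taylorBox a φ M p (r + 1) * derivative ℝ φ -
      derivative ℝ (taylorBox a φ M p r) := by
  have hd : derivative ℝ (taylorBox a φ M p r) =
      ∑ k ∈ Finset.range M, ∑ l ∈ Finset.range (M + 1),
        PowerSeries.C (a (p + 1 + k) (r + l)) * (dividedPow PowerSeries.X k * dividedPow φ l) +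
      (∑ k ∈ Finset.range (M + 1), ∑ l ∈ Finset.range M,
        PowerSeries.C (a (p + k) (r + 1 + l)) *
          (dividedPow PowerSeries.X k * dividedPow φ l)) * derivative ℝ φ := by
    have h₁ (k l : ℕ) : derivative ℝ (PowerSeries.C (a (p + k) (r + l)) *
        (dividedPow PowerSeries.X k * dividedPow φ l)) =
        PowerSeries.C (a (p + k) (r + l)) *
          (derivative ℝ (dividedPow PowerSeries.X k) * dividedPow φ l) +
        PowerSeries.C (a (p + k) (r + l)) *
          (dividedPow PowerSeries.X k * derivative ℝ (dividedPow φ l)) := by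
      simp only [Derivation.leibniz, PowerSeries.derivative_C, smul_eq_mul]
      ring
    simp only [taylorBox, map_sum, h₁, Finset.sum_add_distrib]
    congr 1
    · rw [Finset.sum_range_succ']
      simp only [dividedPow_zero, PowerSeries.derivative_one, zero_mul, mul_zero,
        Finset.sum_const_zero, add_zero, derivative_dividedPow_succ, PowerSeries.derivative_X,
        mul_one, add_assoc, add_comm 1]
    · rw [Finset.sum_mul]
      refine Finset.sum_congr rfl fun k _ => ?_
      rw [Finset.sum_range_succ', Finset.sum_mul]
      simp only [dividedPow_zero, PowerSeries.derivative_one, mul_zero, add_zero,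
        derivative_dividedPow_succ, add_assoc, add_comm 1, mul_assoc]
  have hfst : taylorBox a φ M (p + 1) r = ∑ k ∈ Finset.range M, ∑ l ∈ Finset.range (M + 1),
        PowerSeries.C (a (p + 1 + k) (r + l)) * (dividedPow PowerSeries.X k * dividedPow φ l) +
      ∑ l ∈ Finset.range (M + 1),
        PowerSeries.C (a (p + 1 + M) (r + l)) *
          (dividedPow PowerSeries.X M * dividedPow φ l) := by
    rw [taylorBox, Finset.sum_range_succ]
  have hsnd : taylorBox a φ M p (r + 1) = ∑ k ∈ Finset.range (M + 1), ∑ l ∈ Finset.range M,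
        PowerSeries.C (a (p + k) (r + 1 + l)) * (dividedPow PowerSeries.X k * dividedPow φ l) +
      ∑ k ∈ Finset.range (M + 1),
        PowerSeries.C (a (p + k) (r + 1 + M)) *
          (dividedPow PowerSeries.X k * dividedPow φ M) := by
    rw [taylorBox, ← Finset.sum_add_distrib]
    exact Finset.sum_congr rfl fun k _ => Finset.sum_range_succ _ _
  rw [hd, hfst, hsnd, add_mul, add_sub_add_comm, add_sub_cancel_left, add_sub_cancel_left]
  refine dvd_add (Finset.dvd_sum fun l _ => ?_) (Dvd.dvd.mul_right (Finset.dvd_sum fun k _ => ?_) _)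
  · exact ((X_pow_dvd_dividedPow PowerSeries.constantCoeff_X M).mul_right _).mul_left _
  · exact ((X_pow_dvd_dividedPow hφ M).mul_left _).mul_left _

/-- A family of power series satisfying the chain rule along `(X, φ)` is determined, to any
order, by its constant coefficients through the Taylor polynomial. -/
theorem X_pow_dvd_sub_taylorBox {L : ℕ → ℕ → ℝ⟦X⟧} {φ : ℝ⟦X⟧} (hφ : constantCoeff φ = 0)
    (hL : ∀ p r, derivative ℝ (L p r) = L (p + 1) r + L p (r + 1) * derivative ℝ φ)
    {M i : ℕ} (hi : i ≤ M + 1) (p r : ℕ) :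
    PowerSeries.X ^ i ∣ L p r - taylorBox (fun p r => constantCoeff (L p r)) φ M p r := by
  induction i generalizing p r with
  | zero => simp
  | succ i ih =>
    refine X_pow_succ_dvd_of_X_pow_dvd_derivative ?_ ?_
    · rw [map_sub, constantCoeff_taylorBox _ hφ, sub_self]
    · have h₁ := ih (by omega) (p + 1) r
      have h₂ := (ih (by omega) p (r + 1)).mul_right (derivative ℝ φ)
      have h₃ := (pow_dvd_pow PowerSeries.X (by omega : i ≤ M)).trans
        (X_pow_dvd_derivative_taylorBox_sub (fun p r => constantCoeff (L p r)) hφ M p r)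
      convert dvd_add (dvd_add h₁ h₂) h₃ using 1
      rw [map_sub, hL]
      ring

end TaylorSeries

section ImplicitFunction

open scoped PowerSeries
open PowerSeries (coeff constantCoeff derivative)

theorem Amem.support_subset {n : ℕ} {m : (ℕ × ℕ) →₀ ℕ} (hm : Amem n m) :
    m.support ⊆
      (Finset.range (n + 1) ×ˢ Finset.range (n + 1)).filter fun p => 2 ≤ p.1 + p.2 := by
  obtain ⟨h₁, h₂, h₃⟩ := hm
  intro p hp
  have hle : p.1 + p.2 - 1 ≤ m.sum fun p k => (p.1 + p.2 - 1) * k :=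
    (Nat.le_mul_of_pos_right _ (Nat.pos_of_ne_zero (Finsupp.mem_support_iff.mp hp))).trans
      (Finset.single_le_sum (f := fun p => (p.1 + p.2 - 1) * m p) (fun _ _ => Nat.zero_le _) hp)
  have hsum : (m.sum fun p k => (p.1 + p.2 - 1) * k) + (m.sum fun _ k => k) =
      (m.sum fun p k => p.1 * k) + (m.sum fun p k => p.2 * k) := by
    simp only [Finsupp.sum, ← Finset.sum_add_distrib]
    refine Finset.sum_congr rfl fun q hq => ?_
    obtain ⟨t, ht⟩ : ∃ t, q.1 + q.2 = t + 1 := ⟨q.1 + q.2 - 1, by have := h₁ q hq; omega⟩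
    rw [← add_mul, ht, Nat.add_sub_cancel]
    ring
  have := h₁ p hp
  simp only [Finset.mem_filter, Finset.mem_product, Finset.mem_range]
  omega

/-- The formal Taylor series of an implicit function annihilates the Taylor polynomials of its
defining equation to high order. -/
theorem X_pow_dvd_taylorBox_of_implicit {f : ℝ → ℝ → ℝ} {x₀ : ℝ} {y : ℝ → ℝ}
    (hf : ∀ᶠ p in 𝓝 (x₀, y x₀), ContDiffAt ℝ (⊤ : ℕ∞) (Function.uncurry f) p)
    (hy : ∀ᶠ x in 𝓝 x₀, ContDiffAt ℝ (⊤ : ℕ∞) y x)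
    (himp : ∀ᶠ x in 𝓝 x₀, f x (y x) = 0) (n : ℕ) :
    PowerSeries.X ^ (n + 1) ∣ taylorBox (fun p r => pd f p r x₀ (y x₀))
      (taylorPowerSeries y x₀ - PowerSeries.C (y x₀)) n 0 0 := by
  obtain ⟨U, hUf, hU, hq₀⟩ := eventually_nhds_iff.mp hf
  have hy₀ := hy.self_of_nhds
  have hUx : ∀ᶠ x in 𝓝 x₀, (x, y x) ∈ U :=
    (continuousAt_id.prodMk hy₀.continuousAt).eventually_mem (hU.mem_nhds hq₀)
  have hsm (p r : ℕ) : ContDiffAt ℝ (⊤ : ℕ∞) (fun x => pd f p r x (y x)) x₀ :=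
    ContDiffAt.comp (f := fun x => (x, y x)) x₀ (contDiffAt_pd hU hUf p r _ hq₀)
      (contDiffAt_id.prodMk hy₀)
  have hdy : ContDiffAt ℝ (⊤ : ℕ∞) (deriv y) x₀ := by
    have := (hy₀.fderiv_right (m := (⊤ : ℕ∞)) (by simp)).clm_apply
      (contDiffAt_const (c := (1 : ℝ)))
    simpa using this
  have hL (p r : ℕ) : derivative ℝ (taylorPowerSeries (fun x => pd f p r x (y x)) x₀) =
      taylorPowerSeries (fun x => pd f (p + 1) r x (y x)) x₀ +
        taylorPowerSeries (fun x => pd f p (r + 1) x (y x)) x₀ *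
          derivative ℝ (taylorPowerSeries y x₀ - PowerSeries.C (y x₀)) := by
    rw [map_sub, PowerSeries.derivative_C, sub_zero, derivative_taylorPowerSeries,
      derivative_taylorPowerSeries, ← taylorPowerSeries_mul (hsm _ _) hdy,
      ← taylorPowerSeries_add (hsm _ _) ((hsm _ _).mul hdy)]
    refine taylorPowerSeries_congr ?_
    filter_upwards [hUx, hy] with x hx hyx
    exact deriv_pd_comp hU hUf p r hx (hyx.differentiableAt (by simp))
  have h := X_pow_dvd_sub_taylorBox
    (L := fun p r => taylorPowerSeries (fun x => pd f p r x (y x)) x₀)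
    (by simp [constantCoeff_taylorPowerSeries]) hL (le_refl (n + 1)) 0 0
  have h₀ : taylorPowerSeries (fun x => pd f 0 0 x (y x)) x₀ = 0 := by
    rw [pd_zero_zero, taylorPowerSeries_congr (h := fun _ => 0) himp]
    ext i
    simp [taylorPowerSeries]
  simpa only [h₀, zero_sub, dvd_neg, constantCoeff_taylorPowerSeries] using h

theorem taylorBox_eq_add_sum_filter {a : ℕ → ℕ → ℝ} (h₀₀ : a 0 0 = 0) (h₁₀ : a 1 0 = 0)
    (φ : ℝ⟦X⟧) {n : ℕ} (hn : 1 ≤ n) :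
    taylorBox a φ n 0 0 = PowerSeries.C (a 0 1) * φ +
      ∑ p ∈ (Finset.range (n + 1) ×ˢ Finset.range (n + 1)).filter fun p => 2 ≤ p.1 + p.2,
        PowerSeries.C (a p.1 p.2 / (p.1.factorial * p.2.factorial)) *
          (PowerSeries.X ^ p.1 * φ ^ p.2) := by
  have hterm (p : ℕ × ℕ) : PowerSeries.C (a (0 + p.1) (0 + p.2)) *
      (dividedPow PowerSeries.X p.1 * dividedPow φ p.2) =
      PowerSeries.C (a p.1 p.2 / (p.1.factorial * p.2.factorial)) *
        (PowerSeries.X ^ p.1 * φ ^ p.2) := by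
    rw [dividedPow, dividedPow, zero_add, zero_add, div_eq_mul_inv, mul_inv, map_mul, map_mul]
    ring
  rw [taylorBox, ← Finset.sum_product', Finset.sum_congr rfl fun p _ => hterm p,
    ← Finset.sum_filter_not_add_sum_filter _ fun p : ℕ × ℕ => 2 ≤ p.1 + p.2]
  congr 1
  rw [Finset.sum_eq_single_of_mem (0, 1) (by simp; omega)]
  · simp
  · rintro ⟨k, l⟩ hp hne
    simp only [Finset.mem_filter, not_le] at hp
    obtain ⟨rfl, rfl⟩ | ⟨rfl, rfl⟩ : (k = 0 ∧ l = 0) ∨ (k = 1 ∧ l = 0) := by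
      simp only [ne_eq, Prod.mk.injEq] at hne
      omega
    · simp [h₀₀]
    · simp [h₁₀]

theorem statement13 (f : ℝ → ℝ → ℝ) (x₀ y₀ : ℝ) (y : ℝ → ℝ)
    (hf : ∀ᶠ p in 𝓝 (x₀, y₀), ContDiffAt ℝ (⊤ : ℕ∞) (Function.uncurry f) p)
    (hf0 : f x₀ y₀ = 0) (hfy : pd f 0 1 x₀ y₀ ≠ 0)
    (hfx : pd f 1 0 x₀ y₀ = 0)
    (hy : ∀ᶠ x in 𝓝 x₀, ContDiffAt ℝ (⊤ : ℕ∞) y x)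
    (hy0 : y x₀ = y₀)
    (himp : ∀ᶠ x in 𝓝 x₀, f x (y x) = 0)
    (n : ℕ) (hn : 2 ≤ n) :
    iteratedDeriv n y x₀ =
      ∑ᶠ m ∈ {m : (ℕ × ℕ) →₀ ℕ | Amem n m},
        ((-1 : ℝ) ^ (m.sum fun _ k => k) * (n.factorial : ℝ) *
            ((m.sum fun p k => p.2 * k).factorial : ℝ) /
          (m.prod fun p k =>
            (p.1.factorial : ℝ) ^ k * (p.2.factorial : ℝ) ^ k * (k.factorial : ℝ))) *
        (m.prod fun p k => (pd f p.1 p.2 x₀ y₀) ^ k) /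
        (pd f 0 1 x₀ y₀) ^ (m.sum fun _ k => k) := by
  subst hy0
  obtain ⟨j, rfl⟩ : ∃ j, n = j + 2 := ⟨n - 2, by omega⟩
  set s := (Finset.range (j + 2 + 1) ×ˢ Finset.range (j + 2 + 1)).filter
    fun p : ℕ × ℕ => 2 ≤ p.1 + p.2
  have hs : ∀ p ∈ s, 2 ≤ p.1 + p.2 := fun p hp => (Finset.mem_filter.mp hp).2
  set b := pd f 0 1 x₀ (y x₀)
  set a : ℕ × ℕ → ℝ :=
    fun p => pd f p.1 p.2 x₀ (y x₀) / (p.1.factorial * p.2.factorial) with ha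
  obtain ⟨w, hw⟩ : PowerSeries.X ∣ taylorPowerSeries y x₀ - PowerSeries.C (y x₀) :=
    PowerSeries.X_dvd_iff.mpr (by simp [constantCoeff_taylorPowerSeries])
  obtain ⟨e, he⟩ := X_pow_dvd_taylorBox_of_implicit hf hy himp (j + 2)
  rw [taylorBox_eq_add_sum_filter (by rwa [pd_zero_zero]) hfx _ (by omega), hw] at he
  have hdiv : PowerSeries.C b * w + ∑ p ∈ s, PowerSeries.C (a p) *
      (PowerSeries.X ^ (p.1 + p.2 - 1) * w ^ p.2) = PowerSeries.X ^ (j + 2) * e := by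
    refine mul_left_cancel₀ PowerSeries.X_ne_zero ?_
    rw [← mul_assoc, ← pow_succ', ← he, mul_add, Finset.mul_sum]
    congr 1
    · ring
    · refine Finset.sum_congr rfl fun p hp => ?_
      have hX : (PowerSeries.X : ℝ⟦X⟧) * PowerSeries.X ^ (p.1 + p.2 - 1) =
          PowerSeries.X ^ p.1 * PowerSeries.X ^ p.2 := by
        rw [← pow_succ', ← pow_add]
        congr 1
        have := hs p hp
        omega
      rw [mul_pow, mul_left_comm, ← mul_assoc PowerSeries.X, hX]
      ring
  have hbC : PowerSeries.C b⁻¹ * PowerSeries.C b = (1 : ℝ⟦X⟧) := by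
    rw [← map_mul, inv_mul_cancel₀ hfy, map_one]
  have hw_eq : w = ∑ p ∈ s, PowerSeries.X ^ (p.1 + p.2 - 1) * PowerSeries.C (-a p / b) * w ^ p.2 +
      PowerSeries.X ^ (j + 2) * (PowerSeries.C b⁻¹ * e) := by
    have hneg : ∑ p ∈ s, PowerSeries.X ^ (p.1 + p.2 - 1) * PowerSeries.C (-a p / b) * w ^ p.2 =
        -(PowerSeries.C b⁻¹ * ∑ p ∈ s, PowerSeries.C (a p) *
          (PowerSeries.X ^ (p.1 + p.2 - 1) * w ^ p.2)) := by
      rw [Finset.mul_sum, ← Finset.sum_neg_distrib]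
      refine Finset.sum_congr rfl fun p _ => ?_
      rw [div_eq_mul_inv, map_mul, map_neg]
      ring
    rw [hneg]
    linear_combination PowerSeries.C b⁻¹ * hdiv - w * hbC
  have hw0 : constantCoeff w = 0 := by
    rw [hw_eq, map_add, map_sum, Finset.sum_eq_zero, zero_add]
    · simp
    · intro p hp
      have := hs p hp
      rw [mul_assoc, map_mul, map_pow, PowerSeries.constantCoeff_X, zero_pow (by omega), zero_mul]
  have hcoeff := coeff_eq_finsum_Amem hs hw0 (fun m hm => hm.support_subset) hw_eq
  have hy_coeff : iteratedDeriv (j + 2) y x₀ = ((j + 2).factorial : ℝ) * coeff (j + 1) w := by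
    have h := congrArg (coeff (j + 2)) hw
    rw [PowerSeries.coeff_succ_X_mul, map_sub, PowerSeries.coeff_C, if_neg (by omega), sub_zero,
      taylorPowerSeries, PowerSeries.coeff_mk] at h
    rw [← h, mul_div_cancel₀ _ (Nat.cast_ne_zero.mpr (Nat.factorial_ne_zero _))]
  rw [hy_coeff, hcoeff, ← smul_eq_mul, smul_finsum]
  refine finsum_congr fun m => ?_
  rw [smul_finsum]
  refine finsum_congr fun _ => ?_
  have hprod : (m.prod fun p k => (-a p / b) ^ k) =
      (-1) ^ (m.sum fun _ k => k) * (m.prod fun p k => pd f p.1 p.2 x₀ (y x₀) ^ k) /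
        ((m.prod fun p k => (p.1.factorial : ℝ) ^ k * (p.2.factorial : ℝ) ^ k) *
          b ^ (m.sum fun _ k => k)) := by
    simp only [Finsupp.prod, Finsupp.sum, ← Finset.prod_pow_eq_pow_sum, ← Finset.prod_mul_distrib,
      ← Finset.prod_div_distrib, ← mul_pow, ← div_pow]
    refine Finset.prod_congr rfl fun p _ => ?_
    rw [ha]
    congr 1
    field_simp
  have hden : (m.prod fun p k =>
      (p.1.factorial : ℝ) ^ k * (p.2.factorial : ℝ) ^ k * (k.factorial : ℝ)) =
      (m.prod fun p k => (p.1.factorial : ℝ) ^ k * (p.2.factorial : ℝ) ^ k) *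
        m.prod fun _ k => (k.factorial : ℝ) := Finset.prod_mul_distrib
  rw [hprod, hden, smul_eq_mul]
  simp only [div_eq_mul_inv, mul_inv]
  ring

end ImplicitFunction
end
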